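/- Let ρ: sτtilt Λ → sτtilt Γ be a poset isomorphism and σ: Q_0 → Q'_0 the induced bijection. Then: (1) for any subset V ⊆ Q_0, setting e = Σ_{i∈V} e_i ∈ Λ and e' = Σ_{i∈V} e_{σ(i)} ∈ Γ, ρ induces poset isomorphisms sτtilt_{(0,eΛ)} Λ ≅ sτtilt_{(0,e'Γ)} Γ and sτtilt_{(eΛ,0)} Λ ≅ sτtilt_{(e'Γ,0)} Γ; (2) supp(ρ(T)) = σ(supp(T)) for every T ∈ sτtilt Λ; in particular, ρ restricts to a poset isomorphism between the subposets of basic τ-tilting modules of Λ and of Γ. -/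

import Mathlib

/-!
Common framework for formalizing statements from
"From support τ-tilting posets to algebras" (R. Kase).

Modules over the basic finite dimensional algebra `Λ` are taken to be *right*
modules, encoded as (left) modules over the opposite ring `Λᵐᵒᵖ`.
τ-rigidity is encoded through the Auslander–Smalø criterion:
`Hom(M, τM) = 0` iff `Ext¹(M, Fac M) = 0`, and the vanishing of `Ext¹(M, X)`
is encoded by the splitting of all short exact sequences `0 → X → E → M → 0`.
-/

open MulOpposite

namespace TauTilting

/-- Bundled modules over `A` (in `Type 0`). -/
abbrev Mdl (A : Type) [Ring A] := ModuleCat.{0} A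

variable {A B : Type} [Ring A] [Ring B]

/-- `X ∈ Fac M` : `X` is a factor of a finite direct sum of copies of `M`. -/
def MemFac (M X : Mdl A) : Prop :=
  ∃ (n : ℕ) (f : (Fin n → M) →ₗ[A] X), Function.Surjective f

/-- Every short exact sequence `0 → X → E → M → 0` splits, i.e. `Ext¹(M, X) = 0`. -/
def Ext1Vanish (M X : Mdl A) : Prop :=
  ∀ (E : Mdl A) (f : X →ₗ[A] E) (g : E →ₗ[A] M),
    Function.Injective f → Function.Surjective g →
    LinearMap.range f = LinearMap.ker g →
    ∃ s : M →ₗ[A] E, g.comp s = LinearMap.id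

/-- `M` is τ-rigid (Auslander–Smalø: `Hom(M, τM) = 0 ↔ Ext¹(M, Fac M) = 0`). -/
def IsTauRigid (M : Mdl A) : Prop :=
  Module.Finite A M ∧ ∀ X : Mdl A, MemFac M X → Ext1Vanish M X

/-- `M` is indecomposable. -/
def IsIndec (M : Mdl A) : Prop :=
  Nontrivial M ∧ ∀ N N' : Submodule A M, IsCompl N N' → N = ⊥ ∨ N' = ⊥

/-- `F` is an (internal) decomposition of `M` into indecomposable direct summands. -/
def IsDecompOf (M : Mdl A) {n : ℕ} (F : Fin n → Submodule A M) : Prop :=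
  iSupIndep F ∧ iSup F = ⊤ ∧ ∀ k, IsIndec (ModuleCat.of A (F k))

/-- `|M| = n` : `M` decomposes into `n` indecomposable direct summands. -/
def HasNumSummands (M : Mdl A) (n : ℕ) : Prop :=
  ∃ F : Fin n → Submodule A M, IsDecompOf M F

/-- `M` is basic: its indecomposable direct summands are pairwise non-isomorphic. -/
def IsBasicMod (M : Mdl A) : Prop :=
  ∃ (n : ℕ) (F : Fin n → Submodule A M), IsDecompOf M F ∧
    ∀ k l : Fin n, k ≠ l → IsEmpty (↥(F k) ≃ₗ[A] ↥(F l))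

def ModIso (M N : Mdl A) : Prop := Nonempty (M ≃ₗ[A] N)

/-- The order on support τ-tilting modules: `M ≤ N ↔ Fac M ⊆ Fac N`. -/
def FacLE (M N : Mdl A) : Prop := ∀ X : Mdl A, MemFac M X → MemFac N X
def FacLT (M N : Mdl A) : Prop := FacLE M N ∧ ¬ FacLE N M
/-- Equality in the poset of iso-classes: mutual `≤`. -/
def PE (M N : Mdl A) : Prop := FacLE M N ∧ FacLE N M

/-- `N` is a direct summand of `M`. -/
def IsSummand (N M : Mdl A) : Prop :=
  ∃ (f : N →ₗ[A] M) (g : M →ₗ[A] N), g.comp f = LinearMap.id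
/-- `N ∈ add M`. -/
def InAdd (N M : Mdl A) : Prop := ∃ n : ℕ, IsSummand N (ModuleCat.of A (Fin n → M))
def HomZero (R M : Mdl A) : Prop := ∀ f : R →ₗ[A] M, f = 0

/-- Direct sum of two bundled modules. -/
def dsum (M N : Mdl A) : Mdl A := ModuleCat.of A (M × N)

/-- Hasse-quiver arrow `M → N` (so `N` is a direct successor of `M`, and `M` a
direct predecessor of `N`) in the poset of all modules satisfying `P`,
ordered by `FacLE`. -/
def HArrow (P : Mdl A → Prop) (M N : Mdl A) : Prop :=
  P M ∧ P N ∧ FacLT N M ∧ ∀ C, P C → FacLT N C → FacLT C M → False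

def IsMaxOf (P : Mdl A → Prop) (T : Mdl A) : Prop := P T ∧ ∀ S, P S → FacLE S T
def IsMinOf (P : Mdl A → Prop) (T : Mdl A) : Prop := P T ∧ ∀ S, P S → FacLE T S

/-- `T` has exactly `n` direct successors (counted up to poset equality). -/
def SuccsCard (P : Mdl A → Prop) (T : Mdl A) (n : ℕ) : Prop :=
  ∃ g : Fin n → Mdl A, (∀ k, HArrow P T (g k)) ∧
    (∀ k l, k ≠ l → ¬ PE (g k) (g l)) ∧ ∀ S, HArrow P T S → ∃ k, PE S (g k)

/-- `T` has exactly `n` direct predecessors (counted up to poset equality). -/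
def PredsCard (P : Mdl A → Prop) (T : Mdl A) (n : ℕ) : Prop :=
  ∃ g : Fin n → Mdl A, (∀ k, HArrow P (g k) T) ∧
    (∀ k l, k ≠ l → ¬ PE (g k) (g l)) ∧ ∀ S, HArrow P S T → ∃ k, PE S (g k)

/-- The poset of modules satisfying `P` (ordered by `FacLE`) is a lattice. -/
def IsLatticeP (P : Mdl A → Prop) : Prop :=
  ∀ M N, P M → P N →
    (∃ J, P J ∧ FacLE M J ∧ FacLE N J ∧ ∀ C, P C → FacLE M C → FacLE N C → FacLE J C) ∧
    (∃ W, P W ∧ FacLE W M ∧ FacLE W N ∧ ∀ C, P C → FacLE C M → FacLE C N → FacLE C W)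

/-- A poset isomorphism between the posets (of isomorphism classes) of modules
satisfying `PA` resp. `PB`, ordered by `FacLE`. -/
structure PosetIsoP (PA : Mdl A → Prop) (PB : Mdl B → Prop) where
  toFun : Mdl A → Mdl B
  invFun : Mdl B → Mdl A
  maps : ∀ M, PA M → PB (toFun M)
  maps' : ∀ N, PB N → PA (invFun N)
  le_iff : ∀ M N, PA M → PA N → (FacLE M N ↔ FacLE (toFun M) (toFun N))
  le_iff' : ∀ M N, PB M → PB N → (FacLE M N ↔ FacLE (invFun M) (invFun N))
  left_inv : ∀ M, PA M → PE (invFun (toFun M)) M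
  right_inv : ∀ N, PB N → PE (toFun (invFun N)) N

/-- A poset isomorphism between the poset of modules satisfying `P` and an
abstract poset `(β, le)`. -/
structure PosetIsoTo (P : Mdl A → Prop) (β : Type) (le : β → β → Prop) where
  toFun : Mdl A → β
  invFun : β → Mdl A
  maps' : ∀ b, P (invFun b)
  le_iff : ∀ M N, P M → P N → (FacLE M N ↔ le (toFun M) (toFun N))
  left_inv : ∀ M, P M → PE (invFun (toFun M)) M
  right_inv : ∀ b, toFun (invFun b) = b

/-! ### Ring-level notions -/

variable (Λ : Type) [Ring Λ]

/-- The right ideal generated by a subset, as a right module (i.e. `Λᵐᵒᵖ`-module). -/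
def rSpan (S : Set Λ) : Submodule Λᵐᵒᵖ Λ := Submodule.span Λᵐᵒᵖ S
/-- The two-sided ideal `(q) = ΛqΛ`, as a right `Λ`-module. -/
def tIdeal (q : Λ) : Submodule Λᵐᵒᵖ Λ := Submodule.span Λᵐᵒᵖ {y : Λ | ∃ a : Λ, y = a * q}
/-- The right `Λ`-module `Λ/S`. -/
def quotMod (S : Submodule Λᵐᵒᵖ Λ) : Mdl Λᵐᵒᵖ := ModuleCat.of Λᵐᵒᵖ (Λ ⧸ S)
/-- `Λ` as a right module over itself. -/
def regMod : Mdl Λᵐᵒᵖ := ModuleCat.of Λᵐᵒᵖ Λ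
/-- The projective right module `xΛ ≅ Λ/(1-x)Λ` attached to an idempotent `x`. -/
def projMod (x : Λ) : Mdl Λᵐᵒᵖ := quotMod Λ (rSpan Λ {1 - x})
/-- The right `Λ`-module `Λ/(1-x)`; for `x = e i` this is the module `X_i`. -/
def cyclicQuot (x : Λ) : Mdl Λᵐᵒᵖ := quotMod Λ (tIdeal Λ (1 - x))

/-- `x` is a primitive idempotent. -/
def IsPrimIdem (x : Λ) : Prop :=
  IsIdempotentElem x ∧ x ≠ 0 ∧
    ∀ a b : Λ, IsIdempotentElem a → IsIdempotentElem b →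
      a * b = 0 → b * a = 0 → a + b = x → a = 0 ∨ b = 0

variable {ι : Type} [Fintype ι]

/-- `e` is a complete family of orthogonal primitive idempotents of `Λ`. -/
def CompletePrimIdems (e : ι → Λ) : Prop :=
  (∀ i, IsPrimIdem Λ (e i)) ∧ (Pairwise fun i j => e i * e j = 0) ∧ ∑ i, e i = 1

/-- `Λ` is basic w.r.t. `e`: the `e i Λ` are pairwise non-isomorphic. -/
def IsBasicAlg (e : ι → Λ) : Prop :=
  ∀ i j : ι, i ≠ j → IsEmpty (↥(projMod Λ (e i)) ≃ₗ[Λᵐᵒᵖ] ↥(projMod Λ (e j)))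

/-- The support `supp(M) = {i | M·eᵢ ≠ 0}` of a right module `M`. -/
def Supp (e : ι → Λ) (M : Mdl Λᵐᵒᵖ) : Set ι := {i | ∃ m : M, op (e i) • m ≠ 0}

/-- Support τ-tilting module: τ-rigid with `|M| = #supp(M)`. -/
def IsSTT (e : ι → Λ) (M : Mdl Λᵐᵒᵖ) : Prop :=
  Module.Finite Λᵐᵒᵖ M ∧ IsTauRigid M ∧ HasNumSummands M (Supp Λ e M).ncard

/-- Basic support τ-tilting module. -/
def IsBSTT (e : ι → Λ) (M : Mdl Λᵐᵒᵖ) : Prop := IsSTT Λ e M ∧ IsBasicMod M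

/-- τ-tilting module: τ-rigid with `|M| = #Q₀`. -/
def IsTauTiltingMod (e : ι → Λ) (M : Mdl Λᵐᵒᵖ) : Prop :=
  IsSTT Λ e M ∧ HasNumSummands M (Fintype.card ι)

open scoped Classical in
/-- The idempotent `1 - e_M = Σ_{i ∉ supp M} e i`. -/
noncomputable def cIdem (e : ι → Λ) (M : Mdl Λᵐᵒᵖ) : Λ :=
  ∑ i : ι, if i ∈ Supp Λ e M then 0 else e i

/-- τ-rigid pair `(M, P)`. -/
def IsTauRigidPair (e : ι → Λ) (M P : Mdl Λᵐᵒᵖ) : Prop :=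
  IsTauRigid M ∧ Module.Finite Λᵐᵒᵖ P ∧ Module.Projective Λᵐᵒᵖ P ∧
    InAdd P (projMod Λ (cIdem Λ e M))

/-- Basic τ-rigid pair. -/
def IsBasicTRP (e : ι → Λ) (M P : Mdl Λᵐᵒᵖ) : Prop :=
  IsTauRigidPair Λ e M P ∧ IsBasicMod M ∧ IsBasicMod P

/-- `T ∈ sτtilt_{(N,R)} Λ`, i.e. `N ∈ add T` and `Hom(R, T) = 0`. -/
def InPairSet (N R T : Mdl Λᵐᵒᵖ) : Prop := InAdd N T ∧ HomZero R T

/-- `Λ` is τ-tilting finite: finitely many basic support τ-tilting modules up to iso. -/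
def TauTiltingFinite (e : ι → Λ) : Prop :=
  ∃ (n : ℕ) (T : Fin n → Mdl Λᵐᵒᵖ), ∀ M, IsBSTT Λ e M → ∃ k, ModIso M (T k)

/-- The Jacobson radical of `Λ`, as a `K`-subspace. -/
noncomputable def radK (K : Type) [CommRing K] (Λ : Type) [Ring Λ] [Algebra K Λ] :
    Submodule K Λ :=
  Submodule.restrictScalars K (sInf {I : Ideal Λ | I.IsMaximal})

/-- Powers of the radical, with `rad⁰ = Λ`. -/
noncomputable def radPow (K : Type) [CommRing K] (Λ : Type) [Ring Λ] [Algebra K Λ] :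
    ℕ → Submodule K Λ
  | 0 => ⊤
  | n + 1 => radK K Λ ^ (n + 1)

/-! ### Quivers, paths and presentations -/

/-- Paths in a quiver with vertex set `ι` and arrow types `Arr i j`. -/
inductive QPath {ι : Type} (Arr : ι → ι → Type) : ι → ι → Type
  | nil (i : ι) : QPath Arr i i
  | cons {i j k : ι} (a : Arr i j) (p : QPath Arr j k) : QPath Arr i k

namespace QPath

variable {ι : Type} {Arr : ι → ι → Type}

/-- The list of visited vertices. -/
def verts : ∀ {i j : ι}, QPath Arr i j → List ι
  | i, _, .nil _ => [i]
  | i, _, .cons _ p => i :: p.verts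

/-- Evaluation of a path in the algebra `Λ` (trivial path at `i` ↦ `e i`). -/
def eval {Λ : Type} [Ring Λ] (e : ι → Λ) (arr : ∀ i j, Arr i j → Λ) :
    ∀ {i j : ι}, QPath Arr i j → Λ
  | _, _, .nil i => e i
  | _, _, .cons a p => arr _ _ a * p.eval e arr

def append : ∀ {i j k : ι}, QPath Arr i j → QPath Arr j k → QPath Arr i k
  | _, _, _, .nil _, q => q
  | _, _, _, .cons a p, q => .cons a (p.append q)

def single {i j : ι} (a : Arr i j) : QPath Arr i j := .cons a (.nil j)

end QPath

/-- The condition `xΛe_j = e_iΛe_j = e_iΛx ≠ 0` on an element `x` of `e_iΛe_j`. -/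
def Gcond (ei ej x : Λ) : Prop :=
  (Set.range fun b => x * b * ej) = (Set.range fun b => ei * b * ej) ∧
  (Set.range fun b => ei * b * x) = (Set.range fun b => ei * b * ej) ∧
  ∃ b, ei * b * ej ≠ 0

/-- `w ∈ G(Q, I)` : `w` contains no cycle as a subpath (equivalently, visits no
vertex twice) and `wΛe_j = e_iΛe_j = e_iΛw ≠ 0`. -/
def GMem (e : ι → Λ) {Arr : ι → ι → Type} (arr : ∀ i j, Arr i j → Λ) {i j : ι}
    (w : QPath Arr i j) : Prop :=
  w.verts.Nodup ∧ Gcond Λ (e i) (e j) (w.eval e arr)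

/-- Condition 1 for a bound quiver: if `e_iΛe_j ≠ 0` then `G^i_j ≠ ∅`. -/
def Cond1 (e : ι → Λ) {Arr : ι → ι → Type} (arr : ∀ i j, Arr i j → Λ) : Prop :=
  ∀ i j : ι, (∃ x, e i * x * e j ≠ 0) → ∃ w : QPath Arr i j, GMem Λ e arr w

/-- Ring-level version of Condition 1 (Lemma `eqcd` (iii)). -/
def Cond1R : Prop :=
  ∀ x y : Λ, IsPrimIdem Λ x → IsPrimIdem Λ y → x * y = 0 → y * x = 0 →
    ∃ w : Λ, (∃ b, w = x * b * y) ∧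
      (Set.range fun b => w * b * y) = (Set.range fun b => x * b * y) ∧
      (Set.range fun b => x * b * w) = (Set.range fun b => x * b * y)

/-- `(e, Arr, arr)` presents `Λ` as the bound quiver algebra `KQ/I` with `Q` its
Gabriel quiver: `e` is a complete family of orthogonal primitive idempotents,
`Λ` is basic, each arrow `a : i → j` is sent to an element of `e_i (rad Λ) e_j`,
and the arrows form a `K`-basis of `rad Λ / rad² Λ`. -/
def IsGabrielPres (K : Type) [Field K] [Algebra K Λ] [DecidableEq ι] (e : ι → Λ)
    (Arr : ι → ι → Type) [∀ i j, Fintype (Arr i j)] (arr : ∀ i j, Arr i j → Λ) : Prop :=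
  CompletePrimIdems Λ e ∧ IsBasicAlg Λ e ∧
  (∀ i j (a : Arr i j), arr i j a ∈ radK K Λ ∧ e i * arr i j a * e j = arr i j a) ∧
  (radK K Λ ≤
    Submodule.span K (Set.range fun p : Σ i : ι, Σ j : ι, Arr i j => arr p.1 p.2.1 p.2.2) ⊔
      radK K Λ * radK K Λ) ∧
  (∀ c : (Σ i : ι, Σ j : ι, Arr i j) → K,
    (∑ p : Σ i : ι, Σ j : ι, Arr i j, c p • arr p.1 p.2.1 p.2.2) ∈ radK K Λ * radK K Λ →
    ∀ p, c p = 0)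

/-! ### Partitions of a quiver, Condition 2 -/

/-- `x` and `y` are adjacent within the vertex subset `S` (undirected). -/
def AdjIn {ι : Type} (Arr : ι → ι → Type) (S : Set ι) (x y : ι) : Prop :=
  x ∈ S ∧ y ∈ S ∧ (Nonempty (Arr x y) ∨ Nonempty (Arr y x))

/-- The full subquiver on `S` is connected. -/
def ConnectedOn {ι : Type} (Arr : ι → ι → Type) (S : Set ι) : Prop :=
  ∀ x ∈ S, ∀ y ∈ S, Relation.ReflTransGen (AdjIn Arr S) x y

/-- Adjacency of parts in the quotient quiver `Q^μ`. -/
def PartAdj {ι : Type} (Arr : ι → ι → Type) {ℓ : ℕ} (μ : ι → Fin ℓ) (u v : Fin ℓ) : Prop :=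
  u ≠ v ∧ ∃ x y, μ x = u ∧ μ y = v ∧ (Nonempty (Arr x y) ∨ Nonempty (Arr y x))

/-- Condition 2: there is a partition `μ` of `Q₀` into connected full subquivers
such that `Q^μ` is a tree (connected with `#arrows = #parts - 1`) and each
`sτtilt Λ^{a,b}_μ` — identified with the subposet of `sτtilt Λ` of modules
supported on the union of the two parts — is a lattice. -/
def Cond2 (e : ι → Λ) (Arr : ι → ι → Type) [∀ i j, Fintype (Arr i j)] : Prop :=
  ∃ (ℓ : ℕ) (μ : ι → Fin ℓ), Function.Surjective μ ∧
    (∀ a : Fin ℓ, ConnectedOn Arr {i | μ i = a}) ∧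
    (∀ u v : Fin ℓ, Relation.ReflTransGen (PartAdj Arr μ) u v) ∧
    Nat.card {p : Σ i : ι, Σ j : ι, Arr i j // μ p.1 ≠ μ p.2.1} = ℓ - 1 ∧
    ∀ a b : Fin ℓ, a ≠ b →
      IsLatticeP (fun T : Mdl Λᵐᵒᵖ => IsBSTT Λ e T ∧ Supp Λ e T ⊆ {i | μ i = a ∨ μ i = b})

/-! ### Correspondence of paths under a quiver isomorphism, and `∼` -/

/-- Transport of paths along a quiver isomorphism `σ : Q° → (Q')°` (defined on
non-loop arrows). -/
inductive PathCorr {ι ι' : Type} {Arr : ι → ι → Type} {Arr' : ι' → ι' → Type}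
    (σ : ι → ι') (σ1 : ∀ i j, i ≠ j → Arr i j → Arr' (σ i) (σ j)) :
    ∀ {i j : ι}, QPath Arr i j → QPath Arr' (σ i) (σ j) → Prop
  | nil (i : ι) : PathCorr σ σ1 (QPath.nil i) (QPath.nil (σ i))
  | cons {i j k : ι} (h : i ≠ j) (a : Arr i j) {p : QPath Arr j k}
      {p' : QPath Arr' (σ j) (σ k)} :
      PathCorr σ σ1 p p' → PathCorr σ σ1 (QPath.cons a p) (QPath.cons (σ1 i j h a) p')

/-- The relation `(Q, I) ∼ (Q', I')`: there is a quiver isomorphism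
`σ : Q° → (Q')°` with (a) `supp(e_{σ(i)}Γ) = σ(supp(e_iΛ))` and (b) `G(Γ) = σ(G(Λ))`. -/
def SimCond {Λ Γ : Type} [Ring Λ] [Ring Γ] {ι ι' : Type}
    (e : ι → Λ) {Arr : ι → ι → Type} (arr : ∀ i j, Arr i j → Λ)
    (f : ι' → Γ) {Arr' : ι' → ι' → Type} (arr' : ∀ i j, Arr' i j → Γ) : Prop :=
  ∃ (σ : ι ≃ ι') (σ1 : ∀ i j, i ≠ j → (Arr i j ≃ Arr' (σ i) (σ j))),
    (∀ i j : ι, (∃ x, e i * x * e j ≠ 0) ↔ ∃ y, f (σ i) * y * f (σ j) ≠ 0) ∧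
    (∀ (i j : ι) (w : QPath Arr i j), GMem Λ e arr w →
      ∃ w' : QPath Arr' (σ i) (σ j),
        PathCorr σ (fun i j h => σ1 i j h) w w' ∧ GMem Γ f arr' w') ∧
    (∀ (i j : ι) (w' : QPath Arr' (σ i) (σ j)), GMem Γ f arr' w' →
      ∃ w : QPath Arr i j,
        PathCorr σ (fun i j h => σ1 i j h) w w' ∧ GMem Λ e arr w)

end TauTilting

namespace TauTilting

section General

variable {A : Type} [Ring A]

theorem MemFac.of_finite {M X : Mdl A} {β : Type} [Finite β] (f : (β → M) →ₗ[A] X)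
    (hf : Function.Surjective f) : MemFac M X := by
  obtain ⟨n, ⟨u⟩⟩ := Finite.exists_equiv_fin β
  exact ⟨n, f.comp (LinearEquiv.funCongrLeft A M u).toLinearMap,
    hf.comp (LinearEquiv.funCongrLeft A M u).surjective⟩

theorem MemFac.of_surjective {M X Y : Mdl A} (h : MemFac M X) (f : X →ₗ[A] Y)
    (hf : Function.Surjective f) : MemFac M Y := by
  obtain ⟨n, g, hg⟩ := h
  exact ⟨n, f.comp g, hf.comp hg⟩

theorem MemFac.refl (M : Mdl A) : MemFac M M :=
  ⟨1, LinearMap.proj 0, fun m => ⟨fun _ => m, rfl⟩⟩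

theorem MemFac.pi {M : Mdl A} {α : Type} [Finite α] (N : α → Mdl A)
    (h : ∀ a, MemFac M (N a)) : MemFac M (ModuleCat.of A (∀ a, N a)) := by
  choose n f hf using h
  refine MemFac.of_finite (β := Σ a, Fin (n a))
    (LinearMap.pi fun a => (f a).comp (LinearMap.funLeft A M fun k => ⟨a, k⟩)) ?_
  intro y
  choose v hv using fun a => hf a (y a)
  exact ⟨fun p => v p.1 p.2, funext fun a => hv a⟩

theorem MemFac.trans {M N X : Mdl A} (h : MemFac M N) (h' : MemFac N X) : MemFac M X := by
  obtain ⟨n, g, hg⟩ := h'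
  exact (MemFac.pi (fun _ : Fin n => N) fun _ => h).of_surjective g hg

theorem facLE_iff_memFac {M N : Mdl A} : FacLE M N ↔ MemFac N M :=
  ⟨fun h => h M (MemFac.refl M), fun h _ => h.trans⟩

theorem MemFac.finite {M X : Mdl A} [Module.Finite A M] (h : MemFac M X) : Module.Finite A X := by
  obtain ⟨n, g, hg⟩ := h
  exact Module.Finite.of_surjective g hg

theorem MemFac.of_span {M X : Mdl A} [Module.Finite A X] (S : Set X)
    (hS : Submodule.span A S = ⊤) (h : ∀ x ∈ S, ∃ u : M →ₗ[A] X, x ∈ LinearMap.range u) :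
    MemFac M X := by
  classical
  have hfg : (Submodule.span A S).FG := hS ▸ Module.Finite.fg_top
  obtain ⟨t, hts, ht⟩ := Submodule.fg_span_iff_fg_span_finset_subset S |>.1 hfg
  choose u hu using fun x : t => h x (hts x.2)
  refine MemFac.of_finite (β := t) (∑ x, (u x).comp (LinearMap.proj x)) ?_
  rw [← LinearMap.range_eq_top, eq_top_iff, ← hS, ht, Submodule.span_le]
  intro x hx
  obtain ⟨m, hm⟩ := hu ⟨x, hx⟩
  refine ⟨Pi.single ⟨x, hx⟩ m, ?_⟩
  rw [LinearMap.sum_apply, Finset.sum_eq_single ⟨x, hx⟩]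
  · simpa using hm
  · intro b _ hb
    simp [Pi.single_eq_of_ne hb]
  · simp

theorem Ext1Vanish.exists_lift {M X E B : Mdl A} (h : Ext1Vanish M X) (f : X →ₗ[A] E)
    (g : E →ₗ[A] B) (hf : Function.Injective f) (hg : Function.Surjective g)
    (hfg : LinearMap.range f = LinearMap.ker g) (u : M →ₗ[A] B) :
    ∃ s : M →ₗ[A] E, g.comp s = u := by
  let W : Submodule A (E × M) :=
    LinearMap.ker (g.comp (LinearMap.fst A E M) - u.comp (LinearMap.snd A E M))
  have hgf : ∀ x, g (f x) = 0 := fun x => by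
    have : f x ∈ LinearMap.ker g := hfg ▸ LinearMap.mem_range_self f x
    exact this
  have hW : ∀ w : W, g w.1.1 = u w.1.2 := fun w => sub_eq_zero.1 w.2
  let f' : X →ₗ[A] W := LinearMap.codRestrict W (LinearMap.prod f 0) fun x => by
    simp [W, hgf]
  obtain ⟨s, hs⟩ := h (ModuleCat.of A W) f' ((LinearMap.snd A E M).comp W.subtype)
    (fun x y hxy => hf (congrArg (fun w : W => w.1.1) hxy))
    (fun m => by
      obtain ⟨y, hy⟩ := hg (u m)
      exact ⟨⟨(y, m), by simp [W, hy]⟩, rfl⟩)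
    (by
      ext w
      constructor
      · rintro ⟨x, rfl⟩
        rfl
      · intro hw
        have h2 : w.1.2 = 0 := hw
        have h1 : w.1.1 ∈ LinearMap.range f := by
          rw [hfg, LinearMap.mem_ker, hW, h2, map_zero]
        obtain ⟨x, hx⟩ := h1
        exact ⟨x, Subtype.ext (Prod.ext hx h2.symm)⟩)
  refine ⟨((LinearMap.fst A E M).comp W.subtype).comp s, ?_⟩
  ext m
  have := hW (s m)
  have h3 : (s m).1.2 = m := LinearMap.congr_fun hs m
  rw [h3] at this
  exact this

theorem Ext1Vanish.pi {X : Mdl A} {α : Type} [Finite α] (N : α → Mdl A)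
    (h : ∀ a, Ext1Vanish (N a) X) : Ext1Vanish (ModuleCat.of A (∀ a, N a)) X := by
  classical
  have := Fintype.ofFinite α
  intro E f g hf hg hfg
  choose s hs using fun a => (h a).exists_lift f g hf hg hfg (LinearMap.single A (fun a => N a) a)
  refine ⟨∑ a, (s a).comp (LinearMap.proj a), ?_⟩
  refine LinearMap.ext fun v : (∀ a, N a) => ?_
  have : ∀ a, g (s a (v a)) = Pi.single a (v a) := fun a => LinearMap.congr_fun (hs a) (v a)
  simpa [this] using Finset.univ_sum_single v

theorem Ext1Vanish.congr {M M' X : Mdl A} (h : Ext1Vanish M X) (u : M ≃ₗ[A] M') :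
    Ext1Vanish M' X := by
  intro E f g hf hg hfg
  obtain ⟨s, hs⟩ := h.exists_lift f g hf hg hfg u.toLinearMap
  refine ⟨s.comp u.symm.toLinearMap, ?_⟩
  rw [← LinearMap.comp_assoc, hs]
  ext
  simp

theorem MemFac.extension {T : Mdl A} (hT : IsTauRigid T) {E : Mdl A} (N : Submodule A E)
    (h1 : MemFac T (ModuleCat.of A N)) (h2 : MemFac T (ModuleCat.of A (E ⧸ N))) :
    MemFac T E := by
  have hv := hT.2 _ h1
  obtain ⟨n, q, hq⟩ := h1
  obtain ⟨m, p, hp⟩ := h2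
  obtain ⟨s, hs⟩ := (Ext1Vanish.pi (fun _ : Fin m => T) fun _ => hv).exists_lift
    (E := E) (B := ModuleCat.of A (E ⧸ N)) N.subtype N.mkQ
    N.injective_subtype N.mkQ_surjective (by simp) p
  refine MemFac.of_finite (β := Fin m ⊕ Fin n)
    (s.comp (LinearMap.funLeft A T Sum.inl) +
      (N.subtype.comp q).comp (LinearMap.funLeft A T Sum.inr)) ?_
  intro y
  obtain ⟨v, hv⟩ := hp (N.mkQ y)
  have h3 : y - s v ∈ N := by
    rw [← Submodule.ker_mkQ N, LinearMap.mem_ker, map_sub, ← hv, sub_eq_zero]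
    exact (LinearMap.congr_fun hs v).symm
  obtain ⟨w, hw⟩ := hq ⟨y - s v, h3⟩
  refine ⟨Sum.elim v w, ?_⟩
  have : ((q w : N) : E) = y - s v := by rw [hw]
  change s v + ((q w : N) : E) = y
  rw [this]
  abel

theorem IsIndec.congr {M N : Mdl A} (h : IsIndec M) (u : M ≃ₗ[A] N) : IsIndec N := by
  obtain ⟨h1, h2⟩ := h
  refine ⟨u.symm.toEquiv.nontrivial, fun N1 N2 hc => ?_⟩
  have := h2 (N1.map u.symm.toLinearMap) (N2.map u.symm.toLinearMap)
    ((Submodule.orderIsoMapComap u.symm).isCompl hc)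
  simpa using this

theorem IsIndec.bijective_or_isNilpotent {M : Mdl A} [IsArtinian A M] [IsNoetherian A M]
    (h : IsIndec M) (φ : M →ₗ[A] M) : Function.Bijective φ ∨ ∃ n, φ ^ n = 0 := by
  obtain ⟨n, hn⟩ := Filter.eventually_atTop.1 (LinearMap.eventually_isCompl_ker_pow_range_pow φ)
  have hn := hn (n + 1) (by omega)
  rcases h.2 _ _ hn with h1 | h1
  · left
    have h2 := hn.sup_eq_top
    rw [h1, bot_sup_eq] at h2
    constructor
    · rw [← LinearMap.ker_eq_bot]
      refine eq_bot_iff.2 (le_trans ?_ h1.le)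
      intro x hx
      rw [LinearMap.mem_ker] at hx ⊢
      rw [pow_succ, Module.End.mul_apply, hx, map_zero]
    · intro y
      obtain ⟨x, hx⟩ := LinearMap.range_eq_top.1 h2 y
      rw [pow_succ', Module.End.mul_apply] at hx
      exact ⟨_, hx⟩
  · exact Or.inr ⟨n + 1, LinearMap.range_eq_bot.1 h1⟩

theorem IsIndec.bijective_or_bijective_sub {M : Mdl A} [IsArtinian A M] [IsNoetherian A M]
    (h : IsIndec M) (φ : M →ₗ[A] M) :
    Function.Bijective φ ∨ Function.Bijective (LinearMap.id - φ : M →ₗ[A] M) := by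
  rcases h.bijective_or_isNilpotent φ with h1 | h1
  · exact Or.inl h1
  · right
    have h2 : IsNilpotent (φ : Module.End A M) := h1
    exact (Module.End.isUnit_iff _).1 h2.isUnit_one_sub

theorem IsIndec.bijective_of_split {M N : Mdl A} (h : IsIndec M) [Nontrivial N]
    (i : N →ₗ[A] M) (r : M →ₗ[A] N) (hri : Function.Bijective (r.comp i)) :
    Function.Bijective i := by
  have hi : Function.Injective i := fun x y hxy => hri.1 (by simp [hxy])
  have hc : IsCompl (LinearMap.range i) (LinearMap.ker r) := by
    constructor
    · rw [Submodule.disjoint_def]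
      rintro _ ⟨x, rfl⟩ hx
      have : x = 0 := hri.1 (by simpa using hx)
      simp [this]
    · rw [codisjoint_iff_le_sup]
      intro m _
      obtain ⟨x, hx⟩ := hri.2 (r m)
      refine Submodule.mem_sup.2 ⟨i x, ⟨x, rfl⟩, m - i x, ?_, by abel⟩
      rw [LinearMap.mem_ker, map_sub, sub_eq_zero]
      exact hx.symm
  refine ⟨hi, ?_⟩
  rcases h.2 _ _ hc with h1 | h1
  · exfalso
    obtain ⟨x, hx⟩ := exists_ne (0 : N)
    refine hx (hi ?_)
    have : i x ∈ LinearMap.range i := ⟨x, rfl⟩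
    rw [h1] at this
    rw [map_zero]
    exact this
  · rw [← LinearMap.range_eq_top]
    have := hc.sup_eq_top
    rwa [h1, sup_bot_eq] at this

end General

section Decomposition

variable {A : Type} [Ring A]

theorem exists_isDecompOf_of_equiv_pi {M : Mdl A} {n : ℕ} (N : Fin n → Mdl A)
    (hN : ∀ k, IsIndec (N k)) (u : M ≃ₗ[A] (∀ k, N k)) :
    ∃ F : Fin n → Submodule A M, IsDecompOf M F ∧ ∀ k, Nonempty (N k ≃ₗ[A] F k) := by
  classical
  let s : ∀ k, N k →ₗ[A] M := fun k => u.symm.toLinearMap.comp (LinearMap.single A (fun k => N k) k)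
  have hs : ∀ k, Function.Injective (s k) := fun k =>
    u.symm.injective.comp (Pi.single_injective (M := fun k => N k) k)
  let v : ∀ k, N k ≃ₗ[A] LinearMap.range (s k) := fun k => LinearEquiv.ofInjective (s k) (hs k)
  have hsum : ∀ w : (∀ k, N k), u.symm w = ∑ k, s k (w k) := fun w => by
    conv_lhs => rw [← Finset.univ_sum_single w, map_sum]
    rfl
  refine ⟨fun k => LinearMap.range (s k), ⟨?_, ?_, fun k => (hN k).congr (v k)⟩, fun k => ⟨v k⟩⟩
  · intro k
    let p : M →ₗ[A] N k := (LinearMap.proj k).comp u.toLinearMap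
    have hp : ∀ j x, p (s j x) = (Pi.single j x : ∀ k, N k) k := fun j x => by simp [p, s]
    have h1 : (⨆ (j) (_ : j ≠ k), LinearMap.range (s j)) ≤ LinearMap.ker p := by
      refine iSup₂_le fun j hj => ?_
      rintro _ ⟨x, rfl⟩
      rw [LinearMap.mem_ker, hp, Pi.single_eq_of_ne hj.symm]
    refine Disjoint.mono_right h1 ?_
    rw [Submodule.disjoint_def]
    rintro _ ⟨x, rfl⟩ hx
    rw [LinearMap.mem_ker, hp, Pi.single_eq_same] at hx
    rw [hx, map_zero]
  · rw [eq_top_iff]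
    intro m _
    rw [← u.symm_apply_apply m, hsum]
    exact Submodule.sum_mem _ fun k _ => Submodule.mem_iSup_of_mem k ⟨_, rfl⟩

theorem IsDecompOf.nonempty_equiv {M : Mdl A} {n : ℕ} {F : Fin n → Submodule A M}
    (h : IsDecompOf M F) : Nonempty (M ≃ₗ[A] (∀ k, F k)) := by
  classical
  have hi := DirectSum.isInternal_submodule_of_iSupIndep_of_iSup_eq_top h.1 h.2.1
  exact ⟨(LinearEquiv.ofBijective (DirectSum.coeLinearMap F) hi).symm.trans
    (DirectSum.linearEquivFunOnFintype A (Fin n) fun k => F k)⟩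

theorem hasNumSummands_isBasicMod_of_equiv_pi {M : Mdl A} {α : Type} [Finite α] (N : α → Mdl A)
    (hN : ∀ a, IsIndec (N a)) (hne : ∀ a b, a ≠ b → IsEmpty (N a ≃ₗ[A] N b))
    (u : M ≃ₗ[A] (∀ a, N a)) : HasNumSummands M (Nat.card α) ∧ IsBasicMod M := by
  let c : Fin (Nat.card α) ≃ α := (Finite.equivFin α).symm
  obtain ⟨F, hF, hv⟩ := exists_isDecompOf_of_equiv_pi (fun k => N (c k)) (fun k => hN (c k))
    (u.trans (LinearEquiv.piCongrLeft A (fun a => N a) c).symm)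
  refine ⟨⟨F, hF⟩, ⟨_, F, hF, fun k l hkl => ⟨fun w => ?_⟩⟩⟩
  obtain ⟨vk⟩ := hv k
  obtain ⟨vl⟩ := hv l
  exact (hne (c k) (c l) (c.injective.ne hkl)).false ((vk.trans w).trans vl.symm)

theorem nonempty_equiv_of_prod_equiv {N R N' R' : Type} [AddCommGroup N] [AddCommGroup R]
    [AddCommGroup N'] [AddCommGroup R'] [Module A N] [Module A R] [Module A N'] [Module A R']
    (Φ : (N × R) ≃ₗ[A] (N' × R')) (h : Function.Bijective fun x : N => (Φ (x, 0)).1) :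
    Nonempty (R ≃ₗ[A] R') := by
  let a : N ≃ₗ[A] N' := LinearEquiv.ofBijective
    ((LinearMap.fst A N' R').comp (Φ.toLinearMap.comp (LinearMap.inl A N R))) h
  have ha : ∀ x, a x = (Φ (x, 0)).1 := fun x => rfl
  let c : R →ₗ[A] N := (- a.symm.toLinearMap).comp
    ((LinearMap.fst A N' R').comp (Φ.toLinearMap.comp (LinearMap.inr A N R)))
  have hadd : ∀ x r, Φ (x, r) = Φ (x, 0) + Φ (0, r) := fun x r => by rw [← map_add]; simp
  have hc : ∀ x r, (Φ (x, r)).1 = 0 ↔ x = c r := fun x r => by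
    have h1 : c r = - a.symm (Φ (0, r)).1 := rfl
    rw [hadd, Prod.fst_add, ← ha, h1, ← map_neg, LinearEquiv.eq_symm_apply, add_eq_zero_iff_eq_neg]
  let d : R →ₗ[A] R' := (LinearMap.snd A N' R').comp
    (Φ.toLinearMap.comp (LinearMap.prod c LinearMap.id))
  refine ⟨LinearEquiv.ofBijective d ⟨?_, ?_⟩⟩
  · rw [injective_iff_map_eq_zero]
    intro r hr
    have h2 : Φ (c r, r) = 0 := Prod.ext ((hc _ _).2 rfl) hr
    have h3 := (LinearEquiv.map_eq_zero_iff Φ).1 h2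
    exact congrArg Prod.snd h3
  · intro y
    have h2 : Φ (Φ.symm (0, y)) = (0, y) := Φ.apply_symm_apply _
    have h3 : (Φ.symm (0, y)).1 = c (Φ.symm (0, y)).2 := (hc _ _).1 (congrArg Prod.fst h2)
    refine ⟨(Φ.symm (0, y)).2, ?_⟩
    change (Φ (c (Φ.symm (0, y)).2, (Φ.symm (0, y)).2)).2 = y
    rw [← h3]
    exact congrArg Prod.snd h2

theorem IsIndec.exists_bijective_of_sum {M : Mdl A} [IsArtinian A M] [IsNoetherian A M]
    (h : IsIndec M) {α : Type} (s : Finset α) (φ : α → M →ₗ[A] M) :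
    Function.Bijective (∑ a ∈ s, φ a : M →ₗ[A] M) → ∃ a ∈ s, Function.Bijective (φ a) := by
  classical
  have := h.1
  induction s using Finset.induction_on with
  | empty =>
    intro hb
    obtain ⟨x, hx⟩ := exists_ne (0 : M)
    exact absurd (hb.1 (by simp : _ = (∑ a ∈ ∅, φ a : M →ₗ[A] M) 0)) hx
  | insert a s ha ih =>
    intro hb
    rw [Finset.sum_insert ha] at hb
    let w := LinearEquiv.ofBijective _ hb
    rcases h.bijective_or_bijective_sub (w.symm.toLinearMap.comp (φ a)) with h1 | h1
    · refine ⟨a, by simp, ?_⟩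
      have := w.bijective.comp h1
      convert this using 1
      ext x
      simp
    · have h2 : Function.Bijective (∑ a ∈ s, φ a : M →ₗ[A] M) := by
        have := w.bijective.comp h1
        convert this using 1
        ext x
        have : w x = φ a x + (∑ a ∈ s, φ a : M →ₗ[A] M) x := rfl
        simp [this]
      obtain ⟨b, hb, hb'⟩ := ih h2
      exact ⟨b, by simp [hb], hb'⟩

theorem card_eq_of_pi_equiv : ∀ (n m : ℕ) (N : Fin n → Mdl A) (N' : Fin m → Mdl A),
    (∀ k, IsIndec (N k)) → (∀ k, IsIndec (N' k)) →
    (∀ k, IsArtinian A (N k)) → (∀ k, IsNoetherian A (N k)) →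
    ((∀ k, N k) ≃ₗ[A] (∀ k, N' k)) → n = m
  | 0, 0, _, _, _, _, _, _, _ => rfl
  | 0, m + 1, N, N', _, h', _, _, u => by
    have := (h' 0).1
    have := u.symm.toEquiv.injective.subsingleton
    exact absurd this (not_subsingleton _)
  | n + 1, 0, N, N', h, _, _, _, u => by
    have := (h 0).1
    have := u.toEquiv.injective.subsingleton
    exact absurd this (not_subsingleton _)
  | n + 1, m + 1, N, N', h, h', hA, hN, u => by
    classical
    have := hA 0
    have := hN 0
    have := (h 0).1
    let i0 := LinearMap.single A (fun k => N k) 0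
    let p0 : (∀ k, N k) →ₗ[A] N 0 := LinearMap.proj 0
    let j : ∀ l, N 0 →ₗ[A] N' l := fun l => (LinearMap.proj l).comp (u.toLinearMap.comp i0)
    let q : ∀ l, N' l →ₗ[A] N 0 := fun l =>
      p0.comp (u.symm.toLinearMap.comp (LinearMap.single A (fun k => N' k) l))
    have hsum : (∑ l, (q l).comp (j l) : N 0 →ₗ[A] N 0) = LinearMap.id := by
      ext x
      have h1 : ∀ w : (∀ k, N' k), ∑ l, p0 (u.symm (Pi.single l (w l))) = p0 (u.symm w) := by
        intro w
        rw [← map_sum, ← map_sum, Finset.univ_sum_single]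
      have h2 := h1 (u (i0 x))
      rw [LinearMap.sum_apply]
      refine h2.trans ?_
      simp [p0, i0]
    obtain ⟨l, -, hl⟩ := (h 0).exists_bijective_of_sum Finset.univ (fun l => (q l).comp (j l))
      (by rw [hsum]; exact Function.bijective_id)
    have hj := (h' l).bijective_of_split (j l) (q l) hl
    let a1 : (∀ k, N k) ≃ₗ[A] (N 0 × ∀ k : Fin n, N (Fin.succ k)) :=
      (Fin.consLinearEquiv A (fun k => N k)).symm
    let a2 : (∀ k, N' k) ≃ₗ[A] (N' l × ∀ k : Fin m, N' (l.succAbove k)) :=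
      LinearEquiv.ofBijective
        ((LinearMap.proj l).prod (LinearMap.pi fun k => LinearMap.proj (l.succAbove k)))
        (Fin.insertNthEquiv (fun k => N' k) l).symm.bijective
    obtain ⟨w⟩ := nonempty_equiv_of_prod_equiv ((a1.symm.trans u).trans a2) (by
      convert hj using 1
      funext x
      change u (Fin.cons x 0) l = u (Pi.single 0 x) l
      have hx : (Fin.cons x 0 : ∀ k, N k) = Pi.single 0 x := by
        funext k
        refine Fin.cases ?_ (fun k => ?_) k <;> simp
      rw [hx])
    have := card_eq_of_pi_equiv n m _ _ (fun k => h k.succ) (fun k => h' (l.succAbove k))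
      (fun k => hA k.succ) (fun k => hN k.succ) w
    omega

theorem HasNumSummands.unique {M : Mdl A} [IsArtinian A M] [IsNoetherian A M] {n m : ℕ}
    (hn : HasNumSummands M n) (hm : HasNumSummands M m) : n = m := by
  obtain ⟨F, hF⟩ := hn
  obtain ⟨F', hF'⟩ := hm
  obtain ⟨u⟩ := hF.nonempty_equiv
  obtain ⟨u'⟩ := hF'.nonempty_equiv
  exact card_eq_of_pi_equiv n m (fun k => ModuleCat.of A (F k)) (fun k => ModuleCat.of A (F' k))
    hF.2.2 hF'.2.2 (fun k => inferInstanceAs (IsArtinian A (F k)))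
    (fun k => inferInstanceAs (IsNoetherian A (F k))) (u.symm.trans u')

end Decomposition

/-- The vertices `i` with `ε i • M ≠ 0`. -/
def vsupp {A : Type} [Ring A] {ι : Type} (ε : ι → A) (M : Mdl A) : Set ι :=
  {i | ∃ m : M, ε i • m ≠ 0}

/-- A complete family of orthogonal idempotents together with modules `P i` representing
`M ↦ ε i • M`, which are indecomposable and pairwise non-isomorphic. -/
structure ProjSystem {A : Type} [Ring A] {ι : Type} [Fintype ι] (ε : ι → A) where
  idem : ∀ i, ε i * ε i = ε i
  orth : ∀ i j, i ≠ j → ε i * ε j = 0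
  sum_eq : ∑ i, ε i = 1
  P : ι → Mdl A
  gen : ∀ i, P i
  smul_gen : ∀ i, ε i • gen i = gen i
  span_gen : ∀ i, Submodule.span A {gen i} = ⊤
  exists_map : ∀ i (M : Mdl A) (m : M), ε i • m = m → ∃ φ : P i →ₗ[A] M, φ (gen i) = m
  indec : ∀ i, IsIndec (P i)
  eq_of_equiv : ∀ i j, Nonempty (P i ≃ₗ[A] P j) → i = j

section Supp

variable {A : Type} [Ring A] {ι : Type} {ε : ι → A}

theorem notMem_vsupp {M : Mdl A} {i : ι} : i ∉ vsupp ε M ↔ ∀ m : M, ε i • m = 0 := by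
  simp [vsupp]

theorem vsupp_subset_of_surjective {M N : Mdl A} (φ : M →ₗ[A] N) (h : Function.Surjective φ) :
    vsupp ε N ⊆ vsupp ε M := by
  rintro i ⟨m, hm⟩
  obtain ⟨x, rfl⟩ := h m
  refine ⟨x, fun hx => hm ?_⟩
  rw [← map_smul, hx, map_zero]

theorem vsupp_subset_of_injective {M N : Mdl A} (φ : M →ₗ[A] N) (h : Function.Injective φ) :
    vsupp ε M ⊆ vsupp ε N := by
  rintro i ⟨m, hm⟩
  refine ⟨φ m, fun hx => hm (h ?_)⟩
  rw [map_smul, hx, map_zero]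

theorem vsupp_pi_subset {α : Type} {N : α → Mdl A} {V : Set ι} (h : ∀ a, vsupp ε (N a) ⊆ V) :
    vsupp ε (ModuleCat.of A (∀ a, N a)) ⊆ V := by
  rintro i ⟨m, hm⟩
  by_contra hi
  refine hm (funext fun a => ?_)
  exact notMem_vsupp.1 (fun hc => hi (h a hc)) (m a)

theorem MemFac.vsupp_subset {M X : Mdl A} (h : MemFac M X) : vsupp ε X ⊆ vsupp ε M := by
  obtain ⟨n, f, hf⟩ := h
  exact (vsupp_subset_of_surjective (M := ModuleCat.of A (Fin n → M)) f hf).trans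
    (vsupp_pi_subset fun _ => subset_rfl)

end Supp

namespace ProjSystem

variable {A : Type} [Ring A] {ι : Type} [Fintype ι] {ε : ι → A} (S : ProjSystem ε)

theorem hom_ext {i : ι} {M : Mdl A} {φ ψ : S.P i →ₗ[A] M} (h : φ (S.gen i) = ψ (S.gen i)) :
    φ = ψ :=
  LinearMap.ext_on (S.span_gen i) (by rintro _ rfl; exact h)

theorem finite (i : ι) : Module.Finite A (S.P i) :=
  ⟨⟨{S.gen i}, by simpa using S.span_gen i⟩⟩

theorem smul_map_gen {i : ι} {M : Mdl A} (φ : S.P i →ₗ[A] M) :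
    ε i • φ (S.gen i) = φ (S.gen i) := by
  rw [← map_smul, S.smul_gen]

theorem exists_lift {i : ι} {M N : Mdl A} (g : M →ₗ[A] N) (hg : Function.Surjective g)
    (φ : S.P i →ₗ[A] N) : ∃ ψ : S.P i →ₗ[A] M, g.comp ψ = φ := by
  obtain ⟨m, hm⟩ := hg (φ (S.gen i))
  obtain ⟨ψ, hψ⟩ := S.exists_map i M (ε i • m) (by rw [← mul_smul, S.idem])
  refine ⟨ψ, S.hom_ext ?_⟩
  rw [LinearMap.comp_apply, hψ, map_smul, hm, S.smul_map_gen]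

theorem projective (i : ι) : Module.Projective A (S.P i) :=
  Module.Projective.of_lifting_property'' fun f hf =>
    S.exists_lift (M := ModuleCat.of A (S.P i →₀ A)) f hf LinearMap.id

theorem exists_smul_ne_zero (S : ProjSystem ε) (M : Mdl A) [Nontrivial M] : ∃ i, i ∈ vsupp ε M := by
  by_contra! h
  obtain ⟨m, hm⟩ := exists_ne (0 : M)
  apply hm
  rw [← one_smul A m, ← S.sum_eq, Finset.sum_smul]
  exact Finset.sum_eq_zero fun i _ => notMem_vsupp.1 (h i) m

theorem exists_map_ne_zero {i : ι} {M : Mdl A} (h : i ∈ vsupp ε M) :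
    ∃ φ : S.P i →ₗ[A] M, φ ≠ 0 := by
  obtain ⟨m, hm⟩ := h
  obtain ⟨φ, hφ⟩ := S.exists_map i M (ε i • m) (by rw [← mul_smul, S.idem])
  exact ⟨φ, fun h0 => hm (by rw [← hφ, h0, LinearMap.zero_apply])⟩

theorem mem_vsupp_of_map {i : ι} {M : Mdl A} {φ : S.P i →ₗ[A] M} (h : φ ≠ 0) :
    i ∈ vsupp ε M := by
  refine ⟨φ (S.gen i), fun h0 => h (S.hom_ext ?_)⟩
  rw [← S.smul_map_gen, h0, LinearMap.zero_apply]

theorem gen_ne_zero (i : ι) : S.gen i ≠ 0 := by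
  intro h
  have := (S.indec i).1
  obtain ⟨x, hx⟩ := exists_ne (0 : S.P i)
  have h1 : x ∈ Submodule.span A {S.gen i} := S.span_gen i ▸ Submodule.mem_top
  rw [h] at h1
  exact hx (by simpa using h1)

theorem self_mem_vsupp (i : ι) : i ∈ vsupp ε (S.P i) :=
  ⟨S.gen i, by rw [S.smul_gen]; exact S.gen_ne_zero i⟩

variable [IsArtinianRing A]

theorem eq_top_or_eq_top {i : ι} {B C : Submodule A (S.P i)} (h : B ⊔ C = ⊤) :
    B = ⊤ ∨ C = ⊤ := by
  have := S.finite i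
  obtain ⟨b, hb, c, hc, hbc⟩ := Submodule.mem_sup.1 (h ▸ Submodule.mem_top : S.gen i ∈ B ⊔ C)
  obtain ⟨φ, hφ⟩ := S.exists_map i (ModuleCat.of A B) (ε i • ⟨b, hb⟩)
    (by rw [← mul_smul, S.idem])
  obtain ⟨ψ, hψ⟩ := S.exists_map i (ModuleCat.of A C) (ε i • ⟨c, hc⟩)
    (by rw [← mul_smul, S.idem])
  have hψ' : C.subtype.comp ψ = LinearMap.id - B.subtype.comp φ := by
    refine S.hom_ext ?_
    have h1 : ((φ (S.gen i) : B) : S.P i) = ε i • b := by rw [hφ]; rfl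
    have h2 : ((ψ (S.gen i) : C) : S.P i) = ε i • c := by rw [hψ]; rfl
    change ((ψ (S.gen i) : C) : S.P i) = S.gen i - ((φ (S.gen i) : B) : S.P i)
    rw [h1, h2, eq_sub_iff_add_eq, ← smul_add, add_comm c b, hbc, S.smul_gen]
  have key : ∀ (D : Submodule A (S.P i)) (θ : S.P i →ₗ[A] D),
      Function.Bijective (D.subtype.comp θ) → D = ⊤ := fun D θ hθ => by
    rw [eq_top_iff]
    intro x _
    obtain ⟨y, rfl⟩ := hθ.2 x
    exact (θ y).2
  rcases (S.indec i).bijective_or_bijective_sub (B.subtype.comp φ) with h1 | h1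
  · exact Or.inl (key B φ h1)
  · exact Or.inr (key C ψ (hψ' ▸ h1))

theorem isIndec_of_surjective {i : ι} {N : Mdl A} [Nontrivial N] (q : S.P i →ₗ[A] N)
    (hq : Function.Surjective q) : IsIndec N := by
  refine ⟨inferInstance, fun B C h => ?_⟩
  have key : ∀ D : Submodule A N, D.comap q = ⊤ → D = ⊤ := fun D hD => by
    rw [← Submodule.map_comap_eq_of_surjective hq D, hD, Submodule.map_top,
      LinearMap.range_eq_top.2 hq]
  have h1 : B.comap q ⊔ C.comap q = ⊤ := by
    rw [eq_top_iff]
    intro x _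
    obtain ⟨b, hb, c, hc, hbc⟩ :=
      Submodule.mem_sup.1 (h.sup_eq_top ▸ Submodule.mem_top : q x ∈ B ⊔ C)
    obtain ⟨y, rfl⟩ := hq b
    refine Submodule.mem_sup.2 ⟨y, hb, x - y, ?_, by abel⟩
    rw [Submodule.mem_comap, map_sub, ← hbc, add_sub_cancel_left]
    exact hc
  rcases S.eq_top_or_eq_top h1 with h2 | h2
  · right
    have := h.inf_eq_bot
    rwa [key B h2, top_inf_eq] at this
  · left
    have := h.inf_eq_bot
    rwa [key C h2, inf_top_eq] at this

theorem eq_of_surjective {i j : ι} {N : Mdl A} [Nontrivial N] (q : S.P i →ₗ[A] N)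
    (r : S.P j →ₗ[A] N) (hq : Function.Surjective q) (hr : Function.Surjective r) : i = j := by
  have := S.finite i
  have := (S.indec i).1
  obtain ⟨a, ha⟩ := S.exists_lift r hr q
  obtain ⟨b, hb⟩ := S.exists_lift q hq r
  have h1 : q.comp (b.comp a) = q := by rw [← LinearMap.comp_assoc, hb, ha]
  rcases (S.indec i).bijective_or_isNilpotent (b.comp a) with h2 | ⟨n, hn⟩
  · exact S.eq_of_equiv i j
      ⟨LinearEquiv.ofBijective a ((S.indec j).bijective_of_split a b h2)⟩
  · exfalso
    have h3 : ∀ n, q.comp ((b.comp a) ^ n) = q := fun n => by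
      induction n with
      | zero => rfl
      | succ n ih => rw [pow_succ', Module.End.mul_eq_comp, ← LinearMap.comp_assoc, h1, ih]
    have h4 := h3 n
    rw [hn, LinearMap.comp_zero] at h4
    obtain ⟨x, hx⟩ := exists_ne (0 : N)
    obtain ⟨y, rfl⟩ := hq x
    exact hx (by rw [← h4]; rfl)

theorem vsupp_eq_of_isSimpleModule (S : ProjSystem ε) {i : ι} {M : Mdl A} [IsSimpleModule A M]
    (h : i ∈ vsupp ε M) : vsupp ε M = {i} := by
  have := IsSimpleModule.nontrivial A M
  refine Set.eq_singleton_iff_unique_mem.2 ⟨h, fun j hj => ?_⟩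
  obtain ⟨φ, hφ⟩ := S.exists_map_ne_zero h
  obtain ⟨ψ, hψ⟩ := S.exists_map_ne_zero hj
  exact S.eq_of_surjective ψ φ (LinearMap.surjective_of_ne_zero hψ)
    (LinearMap.surjective_of_ne_zero hφ)

/-- The module `N` surjects onto the simple top of `P i` as soon as it is a nonzero quotient
of `P i`. -/
theorem memFac_of_isSimpleModule {i : ι} {N M : Mdl A} [Nontrivial N] [IsSimpleModule A M]
    (q : S.P i →ₗ[A] N) (hq : Function.Surjective q) (h : i ∈ vsupp ε M) : MemFac N M := by
  obtain ⟨φ, hφ⟩ := S.exists_map_ne_zero h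
  have hφ' := LinearMap.surjective_of_ne_zero hφ
  have hle : LinearMap.ker q ≤ LinearMap.ker φ := by
    by_contra hc
    have hco : IsCoatom (LinearMap.ker φ) := by
      rw [← isSimpleModule_iff_isCoatom]
      exact IsSimpleModule.congr (φ.quotKerEquivOfSurjective hφ')
    have h1 : LinearMap.ker q ⊔ LinearMap.ker φ = ⊤ :=
      (hco.2 _ (lt_of_le_of_ne le_sup_right fun he => hc (he ▸ le_sup_left)))
    rcases S.eq_top_or_eq_top h1 with h2 | h2
    · obtain ⟨x, hx⟩ := exists_ne (0 : N)
      obtain ⟨y, rfl⟩ := hq x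
      exact hx (LinearMap.mem_ker.1 (h2 ▸ Submodule.mem_top))
    · exact hco.1 h2
  obtain ⟨ψ, hψ⟩ : ∃ ψ : N →ₗ[A] M, ψ.comp q = φ := by
    refine ⟨((LinearMap.ker q).liftQ φ hle).comp
      (q.quotKerEquivOfSurjective hq).symm.toLinearMap, ?_⟩
    ext x
    have : (q.quotKerEquivOfSurjective hq).symm (q x) = (LinearMap.ker q).mkQ x := by
      rw [LinearEquiv.symm_apply_eq]; rfl
    simp [this]
  refine (MemFac.refl N).of_surjective ψ fun y => ?_
  obtain ⟨x, rfl⟩ := hφ' y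
  exact ⟨q x, LinearMap.congr_fun hψ x⟩

theorem memFac_of_forall_top {T : Mdl A} (hT : IsTauRigid T) (V : Set ι)
    (hV : ∀ i ∈ V, ∃ N : Mdl A, MemFac T N ∧ Nontrivial N ∧
      ∃ q : S.P i →ₗ[A] N, Function.Surjective q)
    (M : Type) [AddCommGroup M] [Module A M] (hM : IsFiniteLength A M) :
    vsupp ε (ModuleCat.of A M) ⊆ V → MemFac T (ModuleCat.of A M) := by
  induction hM with
  | of_subsingleton =>
    intro _
    exact ⟨0, 0, fun y => ⟨0, Subsingleton.elim _ _⟩⟩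
  | @of_simple_quotient M _ _ N _ _ ih =>
    intro hs
    refine MemFac.extension hT (E := ModuleCat.of A M) N (ih ?_) ?_
    · exact (vsupp_subset_of_injective (M := ModuleCat.of A N) (N := ModuleCat.of A M)
        N.subtype N.injective_subtype).trans hs
    · have hsimp : IsSimpleModule A (ModuleCat.of A (M ⧸ N)) :=
        inferInstanceAs (IsSimpleModule A (M ⧸ N))
      have := IsSimpleModule.nontrivial A (M ⧸ N)
      obtain ⟨i, hi⟩ := S.exists_smul_ne_zero (ModuleCat.of A (M ⧸ N))
      have hiV := hs (vsupp_subset_of_surjective (M := ModuleCat.of A M)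
        (N := ModuleCat.of A (M ⧸ N)) N.mkQ N.mkQ_surjective hi)
      obtain ⟨N', h1, h2, q, hq⟩ := hV i hiV
      exact h1.trans (S.memFac_of_isSimpleModule q hq hi)

end ProjSystem

/-- Basic support τ-tilting modules, with respect to a family of idempotents of `A`. -/
def IsBasicSupportTilting {A : Type} [Ring A] {ι : Type} (ε : ι → A) (M : Mdl A) : Prop :=
  (Module.Finite A M ∧ IsTauRigid M ∧ HasNumSummands M (vsupp ε M).ncard) ∧ IsBasicMod M

namespace ProjSystem

variable {A : Type} [Ring A] {ι : Type} [Fintype ι] {ε : ι → A} (S : ProjSystem ε)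

/-- `Y` is the largest quotient of `P i` supported on `V`. -/
def IsLargestQuotient (V : Set ι) (i : ι) (Y : Mdl A) : Prop :=
  ∃ q : S.P i →ₗ[A] Y, Function.Surjective q ∧ vsupp ε Y ⊆ V ∧
    ∀ (M : Mdl A) (φ : S.P i →ₗ[A] M), vsupp ε M ⊆ V → ∃ ψ : Y →ₗ[A] M, ψ.comp q = φ

theorem exists_isLargestQuotient (V : Set ι) (i : ι) : ∃ Y, S.IsLargestQuotient V i Y := by
  let W : Submodule A (S.P i) := Submodule.span A {x | ∃ j ∉ V, ∃ p : S.P i, x = ε j • p}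
  refine ⟨ModuleCat.of A (S.P i ⧸ W), W.mkQ, W.mkQ_surjective, ?_, fun M φ hM => ?_⟩
  · rintro j ⟨m, hm⟩
    by_contra hj
    obtain ⟨p, rfl⟩ := W.mkQ_surjective m
    apply hm
    rw [← map_smul, ← LinearMap.mem_ker, Submodule.ker_mkQ]
    exact Submodule.subset_span ⟨j, hj, p, rfl⟩
  · refine ⟨W.liftQ φ (Submodule.span_le.2 ?_), W.liftQ_mkQ φ _⟩
    rintro _ ⟨j, hj, p, rfl⟩
    change φ (ε j • p) = 0
    rw [map_smul]
    exact notMem_vsupp.1 (fun h => hj (hM h)) _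

variable {S} in
theorem IsLargestQuotient.ext1Vanish {V : Set ι} {i : ι} {Y X : Mdl A}
    (h : S.IsLargestQuotient V i Y) (hX : vsupp ε X ⊆ V) : Ext1Vanish Y X := by
  obtain ⟨q, hq, hY, hu⟩ := h
  intro E f g hf hg hfg
  have hE : vsupp ε E ⊆ V := by
    rintro j ⟨m, hm⟩
    by_contra hj
    have h1 : g (ε j • m) = 0 := by
      rw [map_smul]
      exact notMem_vsupp.1 (fun h => hj (hY h)) _
    have h2 : ε j • m ∈ LinearMap.range f := by rw [hfg]; exact h1
    obtain ⟨x, hx⟩ := h2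
    apply hm
    rw [← S.idem, mul_smul, ← hx, ← map_smul, notMem_vsupp.1 (fun h => hj (hX h)) x, map_zero]
  obtain ⟨ψ, hψ⟩ := S.exists_lift g hg q
  obtain ⟨s, hs⟩ := hu E ψ hE
  refine ⟨s, LinearMap.ext fun y => ?_⟩
  obtain ⟨x, rfl⟩ := hq y
  have h1 : s (q x) = ψ x := LinearMap.congr_fun hs x
  have h2 : g (ψ x) = q x := LinearMap.congr_fun hψ x
  rw [LinearMap.comp_apply, h1, h2]
  rfl

variable [IsArtinianRing A]

theorem exists_isSimpleModule (S : ProjSystem ε) (i : ι) :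
    ∃ M : Mdl A, IsSimpleModule A M ∧ vsupp ε M = {i} ∧
      ∃ φ : S.P i →ₗ[A] M, Function.Surjective φ := by
  have := S.finite i
  have := (S.indec i).1
  obtain ⟨C, hC, -⟩ := (eq_top_or_exists_le_coatom (⊥ : Submodule A (S.P i))).resolve_left bot_ne_top
  have hs : IsSimpleModule A (ModuleCat.of A (S.P i ⧸ C)) := isSimpleModule_iff_isCoatom.2 hC
  have hn := IsSimpleModule.nontrivial A (ModuleCat.of A (S.P i ⧸ C))
  refine ⟨ModuleCat.of A (S.P i ⧸ C), hs, S.vsupp_eq_of_isSimpleModule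
    (S.mem_vsupp_of_map (φ := C.mkQ) fun h0 => ?_), C.mkQ, C.mkQ_surjective⟩
  obtain ⟨x, hx⟩ := exists_ne (0 : ModuleCat.of A (S.P i ⧸ C))
  obtain ⟨y, rfl⟩ := C.mkQ_surjective x
  exact hx (by rw [h0]; rfl)

variable {S} in
theorem IsLargestQuotient.nontrivial {V : Set ι} {i : ι} {Y : Mdl A}
    (h : S.IsLargestQuotient V i Y) (hi : i ∈ V) : Nontrivial Y := by
  obtain ⟨q, hq, -, hu⟩ := h
  obtain ⟨M, hM, hs, φ, hφ⟩ := S.exists_isSimpleModule i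
  have := IsSimpleModule.nontrivial A M
  obtain ⟨ψ, hψ⟩ := hu M φ (by rw [hs]; simpa using hi)
  have : Function.Surjective ψ := fun y => by
    obtain ⟨x, rfl⟩ := hφ y
    exact ⟨q x, LinearMap.congr_fun hψ x⟩
  exact this.nontrivial

variable {S} in
theorem IsLargestQuotient.mem_vsupp {V : Set ι} {i : ι} {Y : Mdl A}
    (h : S.IsLargestQuotient V i Y) (hi : i ∈ V) : i ∈ vsupp ε Y := by
  have := h.nontrivial hi
  obtain ⟨q, hq, -⟩ := h
  refine S.mem_vsupp_of_map (φ := q) fun h0 => ?_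
  obtain ⟨x, hx⟩ := exists_ne (0 : Y)
  obtain ⟨y, rfl⟩ := hq x
  exact hx (by rw [h0]; rfl)

variable {S} in
theorem isBasicSupportTilting_of_isLargestQuotient {V : Set ι} {Y : V → Mdl A}
    (h : ∀ i : V, S.IsLargestQuotient V i (Y i)) {X : Mdl A} (u : X ≃ₗ[A] (∀ i, Y i)) :
    IsBasicSupportTilting ε X ∧ vsupp ε X = V ∧
      ∀ M : Mdl A, Module.Finite A M → vsupp ε M ⊆ V → MemFac X M := by
  classical
  let pr : ∀ i : V, (∀ i, Y i) →ₗ[A] Y i := fun i => LinearMap.proj i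
  have hnt : ∀ i, Nontrivial (Y i) := fun i => (h i).nontrivial i.2
  have hfin : ∀ i, Module.Finite A (Y i) := fun i => by
    obtain ⟨q, hq, -⟩ := h i
    have := S.finite i
    exact Module.Finite.of_surjective q hq
  have hX : Module.Finite A X := Module.Finite.equiv u.symm
  have hsV : vsupp ε X ⊆ V :=
    (vsupp_subset_of_injective (N := ModuleCat.of A (∀ i, Y i)) u.toLinearMap u.injective).trans
      (vsupp_pi_subset fun i => (h i).choose_spec.2.1)
  have hs : vsupp ε X = V := by
    refine hsV.antisymm fun i hi => ?_
    let p : X →ₗ[A] Y ⟨i, hi⟩ := (pr ⟨i, hi⟩).comp u.toLinearMap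
    have hp : Function.Surjective p := fun y => ⟨u.symm (Pi.single _ y), by simp [p, pr]⟩
    exact vsupp_subset_of_surjective p hp ((h ⟨i, hi⟩).mem_vsupp hi)
  have hd := hasNumSummands_isBasicMod_of_equiv_pi Y
    (fun i => by
      obtain ⟨q, hq, -⟩ := h i
      exact S.isIndec_of_surjective q hq)
    (fun i j hij => ⟨fun w => by
      obtain ⟨q, hq, -⟩ := h i
      obtain ⟨r, hr, -⟩ := h j
      exact hij (Subtype.ext (S.eq_of_surjective (w.toLinearMap.comp q) r
        (w.surjective.comp hq) hr))⟩) u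
  refine ⟨⟨⟨hX, ⟨hX, fun Z hZ => ?_⟩, ?_⟩, hd.2⟩, hs, fun M hM hMV => ?_⟩
  · exact (Ext1Vanish.pi Y fun i => (h i).ext1Vanish (hZ.vsupp_subset.trans hsV)).congr u.symm
  · rw [hs, ← Nat.card_coe_set_eq]
    exact hd.1
  · refine MemFac.of_span {m | ∃ i, ∃ n : M, m = ε i • n} ?_ ?_
    · rw [eq_top_iff]
      intro m _
      rw [← one_smul A m, ← S.sum_eq, Finset.sum_smul]
      exact Submodule.sum_mem _ fun i _ => Submodule.subset_span ⟨i, m, rfl⟩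
    · rintro _ ⟨i, n, rfl⟩
      by_cases hi : i ∈ V
      · obtain ⟨φ, hφ⟩ := S.exists_map i M (ε i • n) (by rw [← mul_smul, S.idem])
        obtain ⟨q, hq, -, hu⟩ := h ⟨i, hi⟩
        obtain ⟨ψ, hψ⟩ := hu M φ hMV
        refine ⟨(ψ.comp (pr ⟨i, hi⟩)).comp u.toLinearMap,
          u.symm (Pi.single ⟨i, hi⟩ (q (S.gen i))), ?_⟩
        rw [← hφ, ← hψ]
        simp [pr]
      · refine ⟨0, 0, ?_⟩
        rw [notMem_vsupp.1 (fun h => hi (hMV h)) n]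
        rfl

theorem exists_supported (S : ProjSystem ε) (V : Set ι) : ∃ X : Mdl A, IsBasicSupportTilting ε X ∧
    vsupp ε X = V ∧ ∀ M : Mdl A, Module.Finite A M → vsupp ε M ⊆ V → MemFac X M := by
  choose Y hY using fun i : V => S.exists_isLargestQuotient V i
  exact ⟨ModuleCat.of A (∀ i, Y i),
    isBasicSupportTilting_of_isLargestQuotient hY (LinearEquiv.refl A _)⟩

variable {S} in
theorem IsLargestQuotient.isBasicSupportTilting {i : ι} {Y : Mdl A}
    (h : S.IsLargestQuotient {i} i Y) : IsBasicSupportTilting ε Y ∧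
    vsupp ε Y = {i} ∧ ∀ M : Mdl A, Module.Finite A M → vsupp ε M ⊆ {i} → MemFac Y M :=
  isBasicSupportTilting_of_isLargestQuotient (V := {i}) (Y := fun _ => Y)
    (by rintro ⟨_, rfl⟩; exact h) (LinearEquiv.piUnique A (fun _ : ({i} : Set ι) => Y)).symm

end ProjSystem

section Approximation

variable {A : Type} [Ring A]

theorem projective_pi {α : Type} [Finite α] (N : α → Mdl A)
    (h : ∀ a, Module.Projective A (N a)) : Module.Projective A (∀ a, N a) := by
  classical
  have := Fintype.ofFinite α
  exact Module.Projective.of_equiv (DirectSum.linearEquivFunOnFintype A α fun a => N a)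

/-- `f : N → P'` is a left minimal left approximation of `N` in `Fac Q` with `P'` projective. -/
structure IsMinApprox (Q : Mdl A) {N P' : Mdl A} (f : N →ₗ[A] P') : Prop where
  finite : Module.Finite A P'
  projective : Module.Projective A P'
  memFac : MemFac Q P'
  exists_extend : ∀ (Y : Mdl A) (φ : N →ₗ[A] Y), MemFac Q Y → ∃ ψ : P' →ₗ[A] Y, ψ.comp f = φ
  surjective_of_comp_eq : ∀ g : P' →ₗ[A] P', g.comp f = f → Function.Surjective g

theorem exists_isMinApprox [IsArtinianRing A] {Q N P' : Mdl A} (f : N →ₗ[A] P')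
    (h1 : Module.Finite A P') (h2 : Module.Projective A P') (h3 : MemFac Q P')
    (h4 : ∀ (Y : Mdl A) (φ : N →ₗ[A] Y), MemFac Q Y → ∃ ψ : P' →ₗ[A] Y, ψ.comp f = φ) :
    ∃ (P'' : Mdl A) (f' : N →ₗ[A] P''), IsMinApprox Q f' := by
  let L : Set ℕ∞ := {l | ∃ (P' : Mdl A) (f : N →ₗ[A] P'), Module.Finite A P' ∧
    Module.Projective A P' ∧ MemFac Q P' ∧
    (∀ (Y : Mdl A) (φ : N →ₗ[A] Y), MemFac Q Y → ∃ ψ : P' →ₗ[A] Y, ψ.comp f = φ) ∧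
    Module.length A P' = l}
  obtain ⟨l, ⟨P', f, h1, h2, h3, h4, hl⟩, hmin⟩ :=
    (wellFounded_lt : WellFounded ((· < ·) : ℕ∞ → ℕ∞ → Prop)).has_min L
      ⟨_, P', f, h1, h2, h3, h4, rfl⟩
  refine ⟨P', f, h1, h2, h3, h4, fun g hg => ?_⟩
  obtain ⟨n, hn⟩ := Filter.eventually_atTop.1 (LinearMap.eventually_isCompl_ker_pow_range_pow g)
  have hn := (hn (n + 1) (by omega)).symm
  have hgn : ∀ n, (g ^ n).comp f = f := fun n => by
    induction n with
    | zero => rfl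
    | succ n ih => rw [pow_succ, Module.End.mul_eq_comp, LinearMap.comp_assoc, hg, ih]
  set D := LinearMap.range (g ^ (n + 1)) with hD
  let p : P' →ₗ[A] D := D.projectionOnto _ hn
  have hp : p.comp D.subtype = LinearMap.id := by
    ext x : 1
    exact Submodule.projectionOnto_apply_left hn x
  have hfD : ∀ x, f x ∈ D := fun x => ⟨f x, LinearMap.congr_fun (hgn (n + 1)) x⟩
  by_cases hDt : D = ⊤
  · intro y
    obtain ⟨x, hx⟩ := LinearMap.range_eq_top.1 hDt y
    rw [pow_succ', Module.End.mul_apply] at hx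
    exact ⟨_, hx⟩
  · exfalso
    refine hmin (Module.length A D) ⟨ModuleCat.of A D, f.codRestrict D hfD,
      inferInstanceAs (Module.Finite A D), Module.Projective.of_split D.subtype p hp,
      h3.of_surjective p fun x => ⟨x, LinearMap.congr_fun hp x⟩, fun Y φ hY => ?_, rfl⟩
      (hl ▸ Submodule.length_lt hDt)
    obtain ⟨ψ, hψ⟩ := h4 Y φ hY
    exact ⟨ψ.comp D.subtype, hψ⟩

namespace IsMinApprox

variable {Q N P' : Mdl A} {f : N →ₗ[A] P'} (h : IsMinApprox Q f)

/-- The cokernel of an approximation. -/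
abbrev coker (f : N →ₗ[A] P') : Mdl A := ModuleCat.of A (P' ⧸ LinearMap.range f)

include h in
theorem surjective_of_bijective (a : P' →ₗ[A] P') (b : N →ₗ[A] N) (hb : Function.Bijective b)
    (hab : a.comp f = f.comp b) : Function.Surjective a := by
  let w := LinearEquiv.ofBijective b hb
  obtain ⟨c, hc⟩ := h.exists_extend P' (f.comp w.symm.toLinearMap) h.memFac
  have h1 : (a.comp c).comp f = f := by
    rw [LinearMap.comp_assoc, hc, ← LinearMap.comp_assoc, hab]
    ext x
    have : b (w.symm x) = x := w.apply_symm_apply x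
    simp [this]
  intro y
  obtain ⟨x, rfl⟩ := h.surjective_of_comp_eq _ h1 y
  exact ⟨c x, rfl⟩

include h in
theorem memFac_coker : MemFac Q (coker f) :=
  h.memFac.of_surjective (LinearMap.range f).mkQ (LinearMap.range f).mkQ_surjective

include h in
theorem ext1Vanish_coker {Y : Mdl A} (hY : MemFac Q Y) : Ext1Vanish (coker f) Y := by
  intro E i g hi hg hig
  have := h.projective
  obtain ⟨t, ht⟩ := Module.projective_lifting_property g (LinearMap.range f).mkQ hg
  have h1 : ∀ x, t (f x) ∈ LinearMap.range i := fun x => by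
    rw [hig, LinearMap.mem_ker]
    refine (LinearMap.congr_fun ht (f x)).trans ?_
    rw [← LinearMap.mem_ker, Submodule.ker_mkQ]
    exact ⟨x, rfl⟩
  let w := LinearEquiv.ofInjective i hi
  obtain ⟨ψ, hψ⟩ := h.exists_extend Y
    (w.symm.toLinearMap.comp ((t.comp f).codRestrict (LinearMap.range i) h1)) hY
  have h2 : ∀ x, i (ψ (f x)) = t (f x) := fun x => by
    have h3 : ψ (f x) = w.symm ⟨t (f x), h1 x⟩ := LinearMap.congr_fun hψ x
    rw [h3]
    exact congrArg Subtype.val (w.apply_symm_apply ⟨t (f x), h1 x⟩)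
  have h3 : ∀ y, g (i y) = 0 := fun y => by
    have : i y ∈ LinearMap.ker g := hig ▸ LinearMap.mem_range_self i y
    exact this
  refine ⟨(LinearMap.range f).liftQ (t - i.comp ψ) ?_, ?_⟩
  · rintro _ ⟨x, rfl⟩
    simp [h2]
  · refine Submodule.linearMap_qext _ (LinearMap.ext fun x => ?_)
    have : g (t x) = (LinearMap.range f).mkQ x := LinearMap.congr_fun ht x
    change g (t x - i (ψ x)) = (LinearMap.range f).mkQ x
    rw [map_sub, h3, sub_zero, this]

include h in
theorem not_projective_coker [Nontrivial (coker f)] : ¬ Module.Projective A (coker f) := by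
  intro hp
  obtain ⟨s, hs⟩ := Module.projective_lifting_property (LinearMap.range f).mkQ
    (LinearMap.id : coker f →ₗ[A] coker f) (LinearMap.range f).mkQ_surjective
  have h0 : ∀ x, (LinearMap.range f).mkQ (f x) = 0 := fun x => by
    rw [← LinearMap.mem_ker, Submodule.ker_mkQ]
    exact ⟨x, rfl⟩
  have h1 := h.surjective_of_comp_eq (LinearMap.id - s.comp (LinearMap.range f).mkQ)
    (LinearMap.ext fun x => by
      change f x - s ((LinearMap.range f).mkQ (f x)) = f x
      rw [h0, map_zero, sub_zero])
  obtain ⟨x, hx⟩ := exists_ne (0 : coker f)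
  obtain ⟨y, rfl⟩ := (LinearMap.range f).mkQ_surjective x
  obtain ⟨z, rfl⟩ := h1 y
  apply hx
  have h2 := LinearMap.congr_fun hs ((LinearMap.range f).mkQ z)
  change (LinearMap.range f).mkQ (z - s ((LinearMap.range f).mkQ z)) = 0
  rw [map_sub, sub_eq_zero]
  exact h2.symm

end IsMinApprox

end Approximation

namespace ProjSystem

variable {A : Type} [Ring A] {ι : Type} [Fintype ι] {ε : ι → A} (S : ProjSystem ε)

open IsMinApprox

theorem exists_lift_coker {Q P₁ P₂ : Mdl A} {j k : ι} {f₁ : S.P j →ₗ[A] P₁} {f₂ : S.P k →ₗ[A] P₂}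
    (h₁ : IsMinApprox Q f₁) (η : coker f₁ →ₗ[A] coker f₂) :
    ∃ (a : P₁ →ₗ[A] P₂) (b : S.P j →ₗ[A] S.P k), a.comp f₁ = f₂.comp b ∧
      (LinearMap.range f₂).mkQ.comp a = η.comp (LinearMap.range f₁).mkQ := by
  have := h₁.projective
  obtain ⟨a, ha⟩ := Module.projective_lifting_property (LinearMap.range f₂).mkQ
    (η.comp (LinearMap.range f₁).mkQ) (LinearMap.range f₂).mkQ_surjective
  have h : ∀ x, a (f₁ x) ∈ LinearMap.range f₂ := fun x => by
    rw [← Submodule.ker_mkQ (LinearMap.range f₂), LinearMap.mem_ker]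
    refine (LinearMap.congr_fun ha (f₁ x)).trans ?_
    have : (LinearMap.range f₁).mkQ (f₁ x) = 0 := by
      rw [← LinearMap.mem_ker, Submodule.ker_mkQ]
      exact ⟨x, rfl⟩
    rw [LinearMap.comp_apply, this, map_zero]
  obtain ⟨b, hb⟩ := S.exists_lift (N := ModuleCat.of A (LinearMap.range f₂)) f₂.rangeRestrict
    f₂.surjective_rangeRestrict ((a.comp f₁).codRestrict _ h)
  refine ⟨a, b, LinearMap.ext fun x => ?_, ha⟩
  exact (congrArg Subtype.val (LinearMap.congr_fun hb x)).symm

variable [IsArtinianRing A]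

theorem isIndec_coker {Q P' : Mdl A} {j : ι} {f : S.P j →ₗ[A] P'} (h : IsMinApprox Q f)
    [Nontrivial (coker f)] : IsIndec (coker f) := by
  have := S.finite j
  refine ⟨inferInstance, fun B D hBD => ?_⟩
  obtain ⟨a, b, hab, ha⟩ := S.exists_lift_coker h (B.projection D hBD)
  have hlift : ∀ x, (LinearMap.range f).mkQ (a x) =
      B.projection D hBD ((LinearMap.range f).mkQ x) := fun x => LinearMap.congr_fun ha x
  rcases (S.indec j).bijective_or_bijective_sub b with hb | hb
  · right
    have h1 := h.surjective_of_bijective a b hb hab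
    have h2 : B = ⊤ := by
      rw [eq_top_iff]
      intro x _
      obtain ⟨y, rfl⟩ := (LinearMap.range f).mkQ_surjective x
      obtain ⟨z, rfl⟩ := h1 y
      rw [hlift]
      exact Submodule.projection_apply_mem hBD _
    have := hBD.inf_eq_bot
    rwa [h2, top_inf_eq] at this
  · left
    have h1 := h.surjective_of_bijective (LinearMap.id - a) _ hb (by
      rw [LinearMap.sub_comp, hab, LinearMap.comp_sub]
      rfl)
    have h2 : D = ⊤ := by
      rw [eq_top_iff]
      intro x _
      obtain ⟨y, rfl⟩ := (LinearMap.range f).mkQ_surjective x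
      obtain ⟨z, rfl⟩ := h1 y
      rw [LinearMap.sub_apply, map_sub, hlift]
      have := Submodule.projection_add_projection_eq_self hBD ((LinearMap.range f).mkQ z)
      rw [LinearMap.id_apply, ← eq_sub_iff_add_eq'.2 this]
      exact Submodule.projection_apply_mem hBD.symm _
    have := hBD.inf_eq_bot
    rwa [h2, inf_top_eq] at this

theorem eq_of_coker_equiv {Q P₁ P₂ : Mdl A} {j k : ι} {f₁ : S.P j →ₗ[A] P₁}
    {f₂ : S.P k →ₗ[A] P₂} (h₁ : IsMinApprox Q f₁) (h₂ : IsMinApprox Q f₂)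
    [Nontrivial (coker f₁)] (w : coker f₁ ≃ₗ[A] coker f₂) : j = k := by
  have := S.finite j
  have := (S.indec j).1
  obtain ⟨a, b, hab, ha⟩ := S.exists_lift_coker h₁ w.toLinearMap
  obtain ⟨a', b', hab', ha'⟩ := S.exists_lift_coker h₂ w.symm.toLinearMap
  rcases (S.indec j).bijective_or_bijective_sub (b'.comp b) with hb | hb
  · exact S.eq_of_equiv j k
      ⟨LinearEquiv.ofBijective b ((S.indec k).bijective_of_split b b' hb)⟩
  · exfalso
    have h1 := h₁.surjective_of_bijective (LinearMap.id - a'.comp a) _ hb (by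
      rw [LinearMap.sub_comp, LinearMap.comp_sub, LinearMap.comp_assoc, hab,
        ← LinearMap.comp_assoc, hab', LinearMap.comp_assoc]
      rfl)
    obtain ⟨x, hx⟩ := exists_ne (0 : coker f₁)
    obtain ⟨y, rfl⟩ := (LinearMap.range f₁).mkQ_surjective x
    obtain ⟨z, rfl⟩ := h1 y
    apply hx
    have h3 : (LinearMap.range f₂).mkQ (a z) = w ((LinearMap.range f₁).mkQ z) :=
      LinearMap.congr_fun ha z
    have h4 : (LinearMap.range f₁).mkQ (a' (a z)) = w.symm ((LinearMap.range f₂).mkQ (a z)) :=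
      LinearMap.congr_fun ha' (a z)
    change (LinearMap.range f₁).mkQ (z - a' (a z)) = 0
    rw [map_sub, h4, h3, sub_eq_zero]
    exact (w.symm_apply_apply _).symm

omit [IsArtinianRing A] in
theorem nontrivial_coker {Q P' : Mdl A} {j : ι} {f : S.P j →ₗ[A] P'} (h : IsMinApprox Q f)
    (hj : j ∈ vsupp ε Q) (hQ : ¬ MemFac Q (S.P j)) : Nontrivial (coker f) := by
  by_contra hn
  rw [not_nontrivial_iff_subsingleton] at hn
  have hf : Function.Surjective f := by
    rw [← LinearMap.range_eq_top]
    exact Submodule.Quotient.subsingleton_iff.1 hn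
  obtain ⟨φ, hφ⟩ := S.exists_map_ne_zero hj
  obtain ⟨ψ, hψ⟩ := h.exists_extend Q φ (MemFac.refl Q)
  have hnt : Nontrivial P' := by
    by_contra hn
    rw [not_nontrivial_iff_subsingleton] at hn
    apply hφ
    rw [← hψ]
    ext x
    rw [LinearMap.comp_apply, Subsingleton.elim (f x) 0, map_zero, LinearMap.zero_apply]
  have := h.projective
  obtain ⟨s, hs⟩ := Module.projective_lifting_property f LinearMap.id hf
  have h1 := (S.indec j).bijective_of_split s f (hs ▸ Function.bijective_id)
  exact hQ (h.memFac.of_surjective s h1.2)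

/-- The direct sum of the `P i` with `i ∈ V`. -/
abbrev projSum (V : Set ι) : Mdl A := ModuleCat.of A (∀ i : V, S.P i)

omit [IsArtinianRing A] in
theorem exists_approx (K : Type) [Field K] [Algebra K A] [FiniteDimensional K A] (V : Set ι)
    (j : ι) : ∃ (P' : Mdl A) (f : S.P j →ₗ[A] P'), Module.Finite A P' ∧
      Module.Projective A P' ∧ MemFac (S.projSum V) P' ∧
      ∀ (Y : Mdl A) (φ : S.P j →ₗ[A] Y), MemFac (S.projSum V) Y →
        ∃ ψ : P' →ₗ[A] Y, ψ.comp f = φ := by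
  classical
  have := S.finite
  have := S.projective
  let Q := S.projSum V
  let _ : Module K Q := Module.compHom Q (algebraMap K A)
  have hsm : ∀ (c : K) (q : Q), c • q = algebraMap K A c • q := fun c q => rfl
  have : IsScalarTower K A Q := ⟨fun c a q => by rw [Algebra.smul_def, mul_smul, hsm]⟩
  have : Module.Finite A Q := inferInstanceAs (Module.Finite A (∀ i : V, S.P i))
  have : Module.Finite K Q := Module.Finite.trans A Q
  let W : Submodule K Q :=
    { carrier := {q | ε j • q = q}
      zero_mem' := smul_zero _
      add_mem' := fun {x y} hx hy => by
        change ε j • (x + y) = x + y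
        rw [smul_add, hx, hy]
      smul_mem' := fun c x hx => by
        change ε j • c • x = c • x
        rw [hsm, ← mul_smul, ← Algebra.commutes, mul_smul, hx] }
  obtain ⟨t, ht⟩ := (inferInstance : IsNoetherian K Q).noetherian W
  have htW : ∀ q : t, ε j • (q : Q) = q := fun q => by
    have : (q : Q) ∈ W := ht ▸ Submodule.subset_span q.2
    exact this
  choose φ hφ using fun q : t => S.exists_map j Q q (htW q)
  let P' : Mdl A := ModuleCat.of A (t → Q)
  let f : S.P j →ₗ[A] P' := LinearMap.pi φ
  have hfac : ∀ θ : S.P j →ₗ[A] Q, ∃ ψ : P' →ₗ[A] Q, ψ.comp f = θ := fun θ => by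
    have h1 : θ (S.gen j) ∈ W := S.smul_map_gen θ
    rw [← ht] at h1
    obtain ⟨c, hc⟩ := Submodule.mem_span_finset'.1 h1
    have hcent : ∀ (c : K), ∃ m : Q →ₗ[A] Q, ∀ q, m q = c • q := fun c =>
      ⟨{ toFun := fun q => c • q
         map_add' := smul_add c
         map_smul' := fun a q => by
          rw [hsm, hsm, RingHom.id_apply, ← mul_smul, ← mul_smul, Algebra.commutes] },
        fun q => rfl⟩
    choose m hm using hcent
    refine ⟨∑ q : t, (m (c q)).comp (LinearMap.proj q), S.hom_ext ?_⟩
    rw [← hc, LinearMap.comp_apply, LinearMap.sum_apply]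
    refine Finset.sum_congr rfl fun q _ => ?_
    change m (c q) (φ q (S.gen j)) = _
    rw [hm, hφ]
  refine ⟨P', f, inferInstanceAs (Module.Finite A (t → ∀ i : V, S.P i)),
    projective_pi (fun _ : t => Q) fun _ => projective_pi _ fun _ => S.projective _, MemFac.pi _ fun _ => MemFac.refl _,
    fun Y θ hY => ?_⟩
  obtain ⟨n, q, hq⟩ := hY
  obtain ⟨θ', hθ'⟩ := S.exists_lift (M := ModuleCat.of A (Fin n → Q)) q hq θ
  choose ψ hψ using fun k : Fin n => hfac ((LinearMap.proj k).comp θ')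
  refine ⟨q.comp (LinearMap.pi ψ), ?_⟩
  rw [LinearMap.comp_assoc, ← hθ']
  congr 1
  exact LinearMap.ext fun x => funext fun k => LinearMap.congr_fun (hψ k) x

omit [IsArtinianRing A] in
theorem exists_mem_of_memFac_projSum {V : Set ι} {M : Mdl A} [Nontrivial M]
    (h : MemFac (S.projSum V) M) : ∃ i ∈ V, i ∈ vsupp ε M := by
  classical
  obtain ⟨n, g, hg⟩ := h
  by_contra! hc
  have h1 : ∀ φ : S.projSum V →ₗ[A] M, φ = 0 := fun φ => by
    refine LinearMap.pi_ext' fun i => ?_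
    rw [LinearMap.zero_comp]
    let φ' : S.P i →ₗ[A] M := φ.comp (LinearMap.single A (fun i : V => S.P i) i)
    by_contra hne
    exact hc i i.2 (S.mem_vsupp_of_map (φ := φ') hne)
  have h2 : g = 0 := LinearMap.pi_ext' fun k =>
    h1 (g.comp (LinearMap.single A (fun _ => S.projSum V) k))
  obtain ⟨x, hx⟩ := exists_ne (0 : M)
  obtain ⟨y, rfl⟩ := hg x
  exact hx (by rw [h2]; rfl)

theorem not_memFac_projSum {V : Set ι} {j : ι} (hj : j ∉ V) : ¬ MemFac (S.projSum V) (S.P j) := by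
  intro h
  obtain ⟨M, hM, hs, φ, hφ⟩ := S.exists_isSimpleModule j
  have := IsSimpleModule.nontrivial A M
  obtain ⟨i, hi, hi'⟩ := S.exists_mem_of_memFac_projSum (h.of_surjective φ hφ)
  rw [hs] at hi'
  exact hj (hi' ▸ hi)

omit [IsArtinianRing A] in
theorem memFac_projSum_iff {V : Set ι} {T : Mdl A} :
    MemFac T (S.projSum V) ↔ ∀ i ∈ V, MemFac T (S.P i) := by
  classical
  refine ⟨fun h i hi => h.of_surjective (X := S.projSum V) (Y := S.P i)
    (LinearMap.proj (φ := fun i : V => S.P i) ⟨i, hi⟩)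
    (LinearMap.proj_surjective (φ := fun i : V => S.P i) ⟨i, hi⟩),
    fun h => MemFac.pi _ fun i => h i i.2⟩

/-- The smallest support tilting module having the `P i` with `i ∈ V` as factors. -/
theorem exists_generated (K : Type) [Field K] [Algebra K A] [FiniteDimensional K A]
    (S : ProjSystem ε) (V : Set ι) :
    ∃ G : Mdl A, IsBasicSupportTilting ε G ∧ MemFac (S.projSum V) G ∧ MemFac G (S.projSum V) := by
  classical
  set Q := S.projSum V with hQdef
  have hVs : ∀ i ∈ V, MemFac Q (S.P i) := S.memFac_projSum_iff.1 (MemFac.refl Q)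
  have hVsupp : V ⊆ vsupp ε Q := fun i hi => (hVs i hi).vsupp_subset (S.self_mem_vsupp i)
  have hN : ∀ j : vsupp ε Q, ∃ N : Mdl A, ((j : ι) ∈ V ∧ Nonempty (S.P j ≃ₗ[A] N)) ∨
      ((j : ι) ∉ V ∧ ∃ (P' : Mdl A) (f : S.P j →ₗ[A] P'), IsMinApprox Q f ∧
        Nontrivial (coker f) ∧ Nonempty (coker f ≃ₗ[A] N)) := fun j => by
    by_cases hj : (j : ι) ∈ V
    · exact ⟨S.P j, Or.inl ⟨hj, ⟨LinearEquiv.refl A _⟩⟩⟩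
    · obtain ⟨P₀, f₀, h1, h2, h3, h4⟩ := S.exists_approx K V j
      obtain ⟨P', f, h⟩ := exists_isMinApprox f₀ h1 h2 h3 h4
      exact ⟨coker f, Or.inr ⟨hj, P', f, h, S.nontrivial_coker h j.2 (S.not_memFac_projSum hj),
        ⟨LinearEquiv.refl A _⟩⟩⟩
  choose N hN using hN
  let G : Mdl A := ModuleCat.of A (∀ j, N j)
  have hQN : ∀ j, MemFac Q (N j) := fun j => by
    rcases hN j with ⟨hj, ⟨w⟩⟩ | ⟨-, P', f, h, -, ⟨w⟩⟩
    · exact (hVs j hj).of_surjective w.toLinearMap w.surjective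
    · exact h.memFac_coker.of_surjective w.toLinearMap w.surjective
  have hQG : MemFac Q G := MemFac.pi _ hQN
  have hGQ : MemFac G Q := S.memFac_projSum_iff.2 fun i hi => by
    have h1 : MemFac G (N ⟨i, hVsupp hi⟩) := (MemFac.refl G).of_surjective (Y := N ⟨i, hVsupp hi⟩)
      (LinearMap.proj (φ := fun j => N j) ⟨i, hVsupp hi⟩)
      (LinearMap.proj_surjective (φ := fun j => N j) ⟨i, hVsupp hi⟩)
    rcases hN ⟨i, hVsupp hi⟩ with ⟨-, ⟨w⟩⟩ | ⟨hj, -⟩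
    · exact h1.of_surjective w.symm.toLinearMap w.symm.surjective
    · exact absurd hi hj
  have hfinQ : Module.Finite A Q := by
    have := S.finite
    exact inferInstanceAs (Module.Finite A (∀ i : V, S.P i))
  have hfin : Module.Finite A G := hQG.finite
  have hd := hasNumSummands_isBasicMod_of_equiv_pi N
    (fun j => by
      rcases hN j with ⟨hj, ⟨w⟩⟩ | ⟨-, P', f, h, hnt, ⟨w⟩⟩
      · exact (S.indec j).congr w
      · exact (S.isIndec_coker h).congr w)
    (fun j k hjk => ⟨fun w => hjk (Subtype.ext (by
      rcases hN j with ⟨hj, ⟨w₁⟩⟩ | ⟨hj, P₁, f₁, h₁, hnt₁, ⟨w₁⟩⟩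
      · rcases hN k with ⟨hk, ⟨w₂⟩⟩ | ⟨hk, P₂, f₂, h₂, hnt₂, ⟨w₂⟩⟩
        · exact S.eq_of_equiv _ _ ⟨w₁.trans (w.trans w₂.symm)⟩
        · have := S.projective j
          exact absurd (Module.Projective.of_equiv (w₁.trans (w.trans w₂.symm)))
            h₂.not_projective_coker
      · rcases hN k with ⟨hk, ⟨w₂⟩⟩ | ⟨hk, P₂, f₂, h₂, hnt₂, ⟨w₂⟩⟩
        · have := S.projective k
          exact absurd (Module.Projective.of_equiv (w₁.trans (w.trans w₂.symm)).symm)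
            h₁.not_projective_coker
        · exact S.eq_of_coker_equiv h₁ h₂ (w₁.trans (w.trans w₂.symm))))⟩)
    (LinearEquiv.refl A G)
  refine ⟨G, ⟨⟨hfin, ⟨hfin, fun Y hY => Ext1Vanish.pi N fun j => ?_⟩, ?_⟩, hd.2⟩, hQG, hGQ⟩
  · rcases hN j with ⟨-, ⟨w⟩⟩ | ⟨-, P', f, h, -, ⟨w⟩⟩
    · exact Ext1Vanish.congr (fun E f g _ hg _ => S.exists_lift g hg LinearMap.id) w
    · exact (h.ext1Vanish_coker (hQG.trans hY)).congr w
  · rw [hGQ.vsupp_subset.antisymm' hQG.vsupp_subset, ← Nat.card_coe_set_eq]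
    exact hd.1

end ProjSystem

theorem isFiniteLength_of_finite {A : Type} [Ring A] [IsArtinianRing A] (M : Type)
    [AddCommGroup M] [Module A M] [Module.Finite A M] : IsFiniteLength A M :=
  isFiniteLength_iff_isNoetherian_isArtinian.2 ⟨inferInstance, inferInstance⟩

namespace ProjSystem

variable {A : Type} [Ring A] {ι : Type} [Fintype ι] {ε : ι → A} (S : ProjSystem ε)
  [IsArtinianRing A]

theorem memFac_of_forall_isLargestQuotient {X : ι → Mdl A}
    (hX : ∀ i, S.IsLargestQuotient {i} i (X i)) {T M : Mdl A} (hT : IsBasicSupportTilting ε T)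
    (hM : Module.Finite A M) {V : Set ι} (hV : ∀ i ∈ V, MemFac T (X i)) (hMV : vsupp ε M ⊆ V) :
    MemFac T M :=
  S.memFac_of_forall_top hT.1.2.1 V
    (fun i hi => ⟨X i, hV i hi, (hX i).nontrivial rfl, (hX i).choose, (hX i).choose_spec.1⟩)
    M (isFiniteLength_of_finite M) hMV

theorem memFac_projSum_iff_forall_not {X : ι → Mdl A}
    (hX : ∀ i, S.IsLargestQuotient {i} i (X i)) {U : Mdl A} (hU : IsBasicSupportTilting ε U)
    (V : Set ι) : MemFac (S.projSum V) U ↔ ∀ j ∉ V, ¬ MemFac U (X j) := by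
  classical
  have hUf := hU.1.1
  constructor
  · intro h j hj hc
    have := (hX j).nontrivial rfl
    obtain ⟨i, hi, hi'⟩ := S.exists_mem_of_memFac_projSum (h.trans hc)
    rw [(hX j).isBasicSupportTilting.2.1] at hi'
    exact hj (hi' ▸ hi)
  · intro h
    by_cases hN : Submodule.span A {x : U | ∃ i ∈ V, ∃ u : U, x = ε i • u} = ⊤
    · refine MemFac.of_span _ hN ?_
      rintro _ ⟨i, hi, u, rfl⟩
      obtain ⟨φ, hφ⟩ := S.exists_map i U (ε i • u) (by rw [← mul_smul, S.idem])
      exact ⟨φ.comp (LinearMap.proj (φ := fun i : V => S.P i) ⟨i, hi⟩),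
        Pi.single ⟨i, hi⟩ (S.gen i), by simp [hφ]⟩
    · exfalso
      obtain ⟨C, hC, hNC⟩ := (eq_top_or_exists_le_coatom _).resolve_left hN
      have hs : IsSimpleModule A (ModuleCat.of A (U ⧸ C)) := isSimpleModule_iff_isCoatom.2 hC
      have hn := IsSimpleModule.nontrivial A (ModuleCat.of A (U ⧸ C))
      obtain ⟨j, hj⟩ := S.exists_smul_ne_zero (ModuleCat.of A (U ⧸ C))
      obtain ⟨φ, hφ⟩ := S.exists_map_ne_zero hj
      refine h j (fun hjV => ?_) (S.memFac_of_forall_top hU.1.2.1 {j} ?_ (X j) ?_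
        (hX j).isBasicSupportTilting.2.1.subset)
      · obtain ⟨m, hm⟩ := hj
        obtain ⟨u, rfl⟩ := C.mkQ_surjective m
        apply hm
        rw [← map_smul, ← LinearMap.mem_ker, Submodule.ker_mkQ]
        exact hNC (Submodule.subset_span ⟨j, hjV, u, rfl⟩)
      · rintro _ rfl
        exact ⟨_, (MemFac.refl U).of_surjective (Y := ModuleCat.of A (U ⧸ C)) C.mkQ
          C.mkQ_surjective, hn, φ, LinearMap.surjective_of_ne_zero hφ⟩
      · have := (hX j).isBasicSupportTilting.1.1.1
        exact isFiniteLength_of_finite (X j)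

end ProjSystem

namespace PosetIsoP

variable {A B : Type} [Ring A] [Ring B] {PA : Mdl A → Prop} {PB : Mdl B → Prop}
  (ρ : PosetIsoP PA PB)

theorem memFac_iff {M N : Mdl A} (hM : PA M) (hN : PA N) :
    MemFac M N ↔ MemFac (ρ.toFun M) (ρ.toFun N) := by
  rw [← facLE_iff_memFac, ← facLE_iff_memFac, ρ.le_iff N M hN hM]

theorem exists_preimage {N : Mdl B} (hN : PB N) :
    ∃ M, PA M ∧ MemFac (ρ.toFun M) N ∧ MemFac N (ρ.toFun M) :=
  ⟨ρ.invFun N, ρ.maps' N hN, facLE_iff_memFac.1 (ρ.right_inv N hN).2,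
    facLE_iff_memFac.1 (ρ.right_inv N hN).1⟩

end PosetIsoP

namespace ProjSystem

variable {A B : Type} [Ring A] [Ring B] [IsArtinianRing A] [IsArtinianRing B]
  {ι ι' : Type} [Fintype ι] [Fintype ι'] {ε : ι → A} {ε' : ι' → B}
  (S : ProjSystem ε) (S' : ProjSystem ε')
  (ρ : PosetIsoP (IsBasicSupportTilting ε) (IsBasicSupportTilting ε'))
  {X : ι → Mdl A} {X' : ι' → Mdl B}
  (hX : ∀ i, S.IsLargestQuotient {i} i (X i)) (hX' : ∀ i, S'.IsLargestQuotient {i} i (X' i))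
  {σ : ι → ι'} (hσ : ∀ i, PE (ρ.toFun (X i)) (X' (σ i)))

include hX hσ

omit [IsArtinianRing B] [Fintype ι'] in
theorem memFac_iff_of_posetIso {T : Mdl A} (hT : IsBasicSupportTilting ε T) (i : ι) :
    MemFac T (X i) ↔ MemFac (ρ.toFun T) (X' (σ i)) := by
  rw [ρ.memFac_iff hT (hX i).isBasicSupportTilting.1]
  exact ⟨fun h => h.trans (facLE_iff_memFac.1 (hσ i).2),
    fun h => h.trans (facLE_iff_memFac.1 (hσ i).1)⟩

include hX'

theorem vsupp_subset_of_posetIso {T : Mdl A} (hT : IsBasicSupportTilting ε T) {V : Set ι}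
    (hV : vsupp ε T ⊆ V) : vsupp ε' (ρ.toFun T) ⊆ σ '' V := by
  obtain ⟨Y, hY, hYs, hYu⟩ := S'.exists_supported (σ '' V)
  obtain ⟨H, hH, hHY, hYH⟩ := ρ.exists_preimage hY
  have h1 : ∀ i ∈ V, MemFac H (X i) := fun i hi => by
    rw [S.memFac_iff_of_posetIso ρ hX hσ hH]
    have h2 := (hX' (σ i)).isBasicSupportTilting
    exact hHY.trans (hYu _ h2.1.1.1 (h2.2.1 ▸ by simpa using ⟨i, hi, rfl⟩))
  have h2 := S.memFac_of_forall_isLargestQuotient hX hH hT.1.1 h1 hV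
  rw [ρ.memFac_iff hH hT] at h2
  exact hYs ▸ (hYH.trans h2).vsupp_subset

theorem bijective_of_posetIso : Function.Bijective σ := by
  constructor
  · intro i j hij
    have hi := (hX i).isBasicSupportTilting
    have h1 := (S.memFac_iff_of_posetIso ρ hX hσ hi.1 i).1 (MemFac.refl _)
    rw [hij, ← S.memFac_iff_of_posetIso ρ hX hσ hi.1 j] at h1
    have h2 := h1.vsupp_subset (ε := ε)
    rw [hi.2.1, (hX j).isBasicSupportTilting.2.1] at h2
    exact (h2 rfl).symm
  · intro j
    obtain ⟨Y, hY, hYs, hYu⟩ := S.exists_supported Set.univ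
    have hj := (hX' j).isBasicSupportTilting
    obtain ⟨H, hH, hHj, -⟩ := ρ.exists_preimage hj.1
    have h1 := (ρ.memFac_iff hY hH).1 (hYu H hH.1.1 (Set.subset_univ _))
    have h2 := (h1.trans hHj).vsupp_subset (ε := ε')
    rw [hj.2.1] at h2
    obtain ⟨i, -, hi⟩ := S.vsupp_subset_of_posetIso S' ρ hX hX' hσ hY (Set.subset_univ _) (h2 rfl)
    exact ⟨i, hi⟩

theorem vsupp_eq_of_posetIso {T : Mdl A} (hT : IsBasicSupportTilting ε T) :
    vsupp ε' (ρ.toFun T) = σ '' vsupp ε T := by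
  refine (S.vsupp_subset_of_posetIso S' ρ hX hX' hσ hT subset_rfl).antisymm ?_
  obtain ⟨Y, hY, hYs, hYu⟩ := S.exists_supported {i | σ i ∈ vsupp ε' (ρ.toFun T)}
  have h1 : MemFac (ρ.toFun Y) (ρ.toFun T) := by
    refine S'.memFac_of_forall_isLargestQuotient hX' (ρ.maps _ hY) (ρ.maps _ hT).1.1
      (fun j hj => ?_) subset_rfl
    obtain ⟨i, rfl⟩ := (S.bijective_of_posetIso S' ρ hX hX' hσ).2 j
    rw [← S.memFac_iff_of_posetIso ρ hX hσ hY]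
    have h2 := (hX i).isBasicSupportTilting
    exact hYu _ h2.1.1.1 (h2.2.1 ▸ by simpa using hj)
  rw [← ρ.memFac_iff hY hT] at h1
  rw [Set.image_subset_iff]
  exact h1.vsupp_subset.trans hYs.subset

theorem memFac_projSum_iff_of_posetIso (K : Type) [Field K] [Algebra K A] [FiniteDimensional K A]
    [Algebra K B] [FiniteDimensional K B] {T : Mdl A} (hT : IsBasicSupportTilting ε T)
    (V : Set ι) :
    MemFac T (S.projSum V) ↔ MemFac (ρ.toFun T) (S'.projSum (σ '' V)) := by
  have hbij := S.bijective_of_posetIso S' ρ hX hX' hσ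
  obtain ⟨G, hG, hQG, hGQ⟩ := S.exists_generated K V
  obtain ⟨G', hG', hQG', hGQ'⟩ := S'.exists_generated K (σ '' V)
  obtain ⟨H, hH, hHG, hGH⟩ := ρ.exists_preimage hG'
  have h1 : MemFac G' (ρ.toFun G) := by
    refine hGQ'.trans ((S'.memFac_projSum_iff_forall_not hX' (ρ.maps _ hG) _).2 fun j hj => ?_)
    obtain ⟨i, rfl⟩ := hbij.2 j
    rw [← S.memFac_iff_of_posetIso ρ hX hσ hG]
    exact (S.memFac_projSum_iff_forall_not hX hG V).1 hQG i fun hi => hj ⟨i, hi, rfl⟩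
  have h2 : MemFac (ρ.toFun G) G' := by
    have h3 : MemFac G H := by
      refine hGQ.trans ((S.memFac_projSum_iff_forall_not hX hH _).2 fun i hi hc => ?_)
      rw [S.memFac_iff_of_posetIso ρ hX hσ hH] at hc
      refine (S'.memFac_projSum_iff_forall_not hX' hG' _).1 hQG' (σ i) ?_ (hGH.trans hc)
      rwa [hbij.1.mem_set_image]
    exact ((ρ.memFac_iff hG hH).1 h3).trans hHG
  calc MemFac T (S.projSum V) ↔ MemFac T G := ⟨fun h => h.trans hQG, fun h => h.trans hGQ⟩
    _ ↔ MemFac (ρ.toFun T) (ρ.toFun G) := ρ.memFac_iff hT hG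
    _ ↔ _ := ⟨fun h => h.trans (h2.trans hGQ'), fun h => h.trans (hQG'.trans h1)⟩

end ProjSystem

section RightModules

variable {Λ : Type} [Ring Λ]

/-- The map `a ↦ m a` from the regular right module. -/
def orbitMap (M : Mdl Λᵐᵒᵖ) (m : M) : Λ →ₗ[Λᵐᵒᵖ] M where
  toFun a := op a • m
  map_add' a b := by rw [op_add, add_smul]
  map_smul' c a := by
    rw [RingHom.id_apply, ← mul_smul]
    rfl

theorem orbitMap_apply (M : Mdl Λᵐᵒᵖ) (m : M) (a : Λ) : orbitMap M m a = op a • m := rfl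

/-- `M` with its element `u` is the quotient of the regular right module by `W`. -/
structure IsQuotientBy (W : Submodule Λᵐᵒᵖ Λ) (M : Mdl Λᵐᵒᵖ) (u : M) : Prop where
  span : Submodule.span Λᵐᵒᵖ {u} = ⊤
  smul_eq_zero : ∀ a ∈ W, op a • u = 0
  exists_map : ∀ (N : Mdl Λᵐᵒᵖ) (n : N), (∀ a ∈ W, op a • n = 0) → ∃ φ : M →ₗ[Λᵐᵒᵖ] N, φ u = n

theorem exists_isQuotientBy (W : Submodule Λᵐᵒᵖ Λ) :
    ∃ u : quotMod Λ W, IsQuotientBy W (quotMod Λ W) u := by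
  have h1 : ∀ a, W.mkQ a = op a • W.mkQ 1 := fun a => by
    rw [← map_smul, op_smul_eq_mul, one_mul]
  refine ⟨W.mkQ 1, ?_, fun a ha => ?_, fun N n hn =>
    ⟨W.liftQ (orbitMap N n) hn, one_smul Λᵐᵒᵖ n⟩⟩
  · rw [eq_top_iff]
    intro y _
    obtain ⟨a, rfl⟩ := W.mkQ_surjective y
    have h2 : op a • W.mkQ 1 ∈ Submodule.span Λᵐᵒᵖ {W.mkQ 1} :=
      Submodule.smul_mem _ _ (Submodule.mem_span_singleton_self _)
    rw [← h1] at h2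
    exact h2
  · have h2 : W.mkQ a = 0 := by rwa [← LinearMap.mem_ker, Submodule.ker_mkQ]
    exact (h1 a).symm.trans h2

theorem surjective_of_span {M N : Mdl Λᵐᵒᵖ} {n : N} (hn : Submodule.span Λᵐᵒᵖ {n} = ⊤)
    (φ : M →ₗ[Λᵐᵒᵖ] N) (u : M) (h : φ u = n) : Function.Surjective φ := by
  rw [← LinearMap.range_eq_top, eq_top_iff, ← hn, Submodule.span_le]
  rintro _ rfl
  exact ⟨_, h⟩

/-- `M` with its element `u` represents the functor `N ↦ N x`. -/
structure Represents (x : Λ) (M : Mdl Λᵐᵒᵖ) (u : M) : Prop where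
  span : Submodule.span Λᵐᵒᵖ {u} = ⊤
  smul_eq : op x • u = u
  exists_map : ∀ (N : Mdl Λᵐᵒᵖ) (n : N), op x • n = n → ∃ φ : M →ₗ[Λᵐᵒᵖ] N, φ u = n

theorem exists_represents (x : Λ) : ∃ u : projMod Λ x, Represents x (projMod Λ x) u := by
  obtain ⟨u, hu⟩ := exists_isQuotientBy (rSpan Λ {1 - x})
  refine ⟨u, hu.span, ?_, fun N n hn => hu.exists_map N n fun a ha => ?_⟩
  · have h := hu.smul_eq_zero _ (Submodule.mem_span_singleton_self _)
    rw [op_sub, sub_smul, op_one, one_smul, sub_eq_zero] at h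
    exact h.symm
  · have h : rSpan Λ {1 - x} ≤ LinearMap.ker (orbitMap N n) := Submodule.span_le.2 (by
      rintro _ rfl
      change op (1 - x) • n = 0
      rw [op_sub, sub_smul, op_one, one_smul, hn, sub_self])
    exact h ha

namespace Represents

variable {x : Λ} {M : Mdl Λᵐᵒᵖ} {u : M} (h : Represents x M u)

include h in
theorem hom_ext {N : Type} [AddCommGroup N] [Module Λᵐᵒᵖ N] {φ ψ : M →ₗ[Λᵐᵒᵖ] N}
    (h' : φ u = ψ u) : φ = ψ :=
  LinearMap.ext_on h.span (by rintro _ rfl; exact h')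

include h in
theorem isIndec (hx : IsPrimIdem Λ x) : IsIndec M := by
  obtain ⟨hxx, hx0, hprim⟩ := hx
  obtain ⟨s, hs⟩ : ∃ s : M →ₗ[Λᵐᵒᵖ] Λ, s u = x := h.exists_map (ModuleCat.of Λᵐᵒᵖ Λ) x hxx
  have hmk : ∀ p, op (s p) • u = p := fun p => by
    have h1 : (orbitMap M u).comp s = LinearMap.id := h.hom_ext (by
      rw [LinearMap.comp_apply, hs, orbitMap_apply, h.smul_eq, LinearMap.id_apply])
    exact LinearMap.congr_fun h1 p
  have hinj : ∀ p, s p = 0 → p = 0 := fun p hp => by rw [← hmk p, hp, op_zero, zero_smul]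
  have hmul : ∀ φ ψ : M →ₗ[Λᵐᵒᵖ] M, s (φ (ψ u)) = s (φ u) * s (ψ u) := fun φ ψ => by
    have h1 := congrArg (fun p => s (φ p)) (hmk (ψ u))
    rw [← h1, map_smul, map_smul, op_smul_eq_mul]
  refine ⟨⟨⟨u, 0, fun h0 => hx0 ?_⟩⟩, fun B D hc => ?_⟩
  · rw [← hs, h0, map_zero]
  · have key : ∀ B D : Submodule Λᵐᵒᵖ M, ∀ hc : IsCompl B D,
        s (B.projection D hc u) = 0 → B = ⊥ := fun B D hc h' => by
      have h0 : B.projection D hc = 0 :=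
        h.hom_ext ((hinj _ h').trans (LinearMap.zero_apply _).symm)
      rw [eq_bot_iff]
      intro y hy
      have h1 := Submodule.projection_apply_left hc ⟨y, hy⟩
      rw [h0] at h1
      exact h1.symm
    have hBB : ∀ (B D : Submodule Λᵐᵒᵖ M) (hc : IsCompl B D) (y : M),
        B.projection D hc (B.projection D hc y) = B.projection D hc y := fun B D hc y =>
      Submodule.projection_apply_left hc ⟨_, Submodule.projection_apply_mem hc y⟩
    have hBD : ∀ (B D : Submodule Λᵐᵒᵖ M) (hc : IsCompl B D) (y : M),
        B.projection D hc (D.projection B hc.symm y) = 0 := fun B D hc y => by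
      simp
    rcases hprim (s (B.projection D hc u)) (s (D.projection B hc.symm u))
      ((hmul _ _).symm.trans (by rw [hBB])) ((hmul _ _).symm.trans (by rw [hBB]))
      (by rw [← hmul, hBD, map_zero]) (by rw [← hmul, hBD D B hc.symm, map_zero])
      (by rw [← map_add, Submodule.projection_add_projection_eq_self, hs]) with h | h
    · exact Or.inl (key B D hc h)
    · exact Or.inr (key D B hc.symm h)

end Represents

variable {ι : Type} [Fintype ι] {e : ι → Λ}

/-- The modules `e i Λ` of a basic algebra. -/
noncomputable def projSystem (he : CompletePrimIdems Λ e) (hb : IsBasicAlg Λ e) :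
    ProjSystem (fun i => op (e i)) where
  idem i := by rw [← op_mul, (he.1 i).1]
  orth i j hij := by rw [← op_mul, he.2.1 hij.symm, op_zero]
  sum_eq := by rw [← Finset.op_sum, he.2.2, op_one]
  P i := projMod Λ (e i)
  gen i := (exists_represents (e i)).choose
  smul_gen i := (exists_represents (e i)).choose_spec.smul_eq
  span_gen i := (exists_represents (e i)).choose_spec.span
  exists_map i := (exists_represents (e i)).choose_spec.exists_map
  indec i := (exists_represents (e i)).choose_spec.isIndec (he.1 i)
  eq_of_equiv i j h := by
    by_contra hij
    exact (hb i j hij).false h.some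

theorem isLargestQuotient_cyclicQuot (he : CompletePrimIdems Λ e) (hb : IsBasicAlg Λ e) (i : ι) :
    (projSystem he hb).IsLargestQuotient {i} i (cyclicQuot Λ (e i)) := by
  set S := projSystem he hb
  obtain ⟨u, hu⟩ : ∃ u : cyclicQuot Λ (e i), IsQuotientBy (tIdeal Λ (1 - e i)) _ u :=
    exists_isQuotientBy (tIdeal Λ (1 - e i))
  have hj : ∀ j, j ≠ i → ∀ y : Λ, op (y * e j) • u = 0 := fun j hj y =>
    hu.smul_eq_zero _ (Submodule.subset_span ⟨y * e j, by
      rw [mul_sub, mul_one, mul_assoc, he.2.1 hj, mul_zero, sub_zero]⟩)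
  have hi : op (e i) • u = u := by
    have h := hu.smul_eq_zero _ (Submodule.subset_span ⟨1, (one_mul _).symm⟩)
    rw [op_sub, sub_smul, op_one, one_smul, sub_eq_zero] at h
    exact h.symm
  obtain ⟨q, hq⟩ := S.exists_map i _ u hi
  refine ⟨q, surjective_of_span hu.span q _ hq, ?_, fun M φ hM => ?_⟩
  · rintro j ⟨m, hm⟩
    by_contra hji
    obtain ⟨y, rfl⟩ := Submodule.mem_span_singleton.1 (hu.span ▸ Submodule.mem_top : m ∈ _)
    apply hm
    rw [← mul_smul]
    exact hj j hji (unop y)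
  · have hfix : ∀ m : M, op (1 - e i) • m = 0 := fun m => by
      have h1 : m = ∑ j, op (e j) • m := by rw [← Finset.sum_smul, S.sum_eq, one_smul]
      rw [Finset.sum_eq_single i (fun j _ hj => notMem_vsupp.1 (fun h => hj (hM h)) m)
        (fun h => absurd (Finset.mem_univ i) h)] at h1
      rw [op_sub, sub_smul, op_one, one_smul, ← h1, sub_self]
    obtain ⟨ψ, hψ⟩ := hu.exists_map M (φ (S.gen i)) fun a ha => by
      have h : tIdeal Λ (1 - e i) ≤ LinearMap.ker (orbitMap M (φ (S.gen i))) :=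
        Submodule.span_le.2 (by
          rintro _ ⟨a, rfl⟩
          change op (a * (1 - e i)) • φ (S.gen i) = 0
          rw [op_mul, mul_smul, hfix])
      exact h ha
    exact ⟨ψ, S.hom_ext (by rw [LinearMap.comp_apply, hq, hψ])⟩

open scoped Classical in
/-- The idempotent `∑ i ∈ V, e i`. -/
noncomputable def sumIdem (e : ι → Λ) (V : Set ι) : Λ := ∑ i : ι, if i ∈ V then e i else 0

theorem mul_sumIdem (he : CompletePrimIdems Λ e) {V : Set ι} {i : ι} (hi : i ∈ V) :
    e i * sumIdem e V = e i := by
  classical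
  rw [sumIdem, Finset.mul_sum, Finset.sum_eq_single i]
  · rw [if_pos hi, (he.1 i).1]
  · intro j _ hj
    split_ifs
    · exact he.2.1 hj.symm
    · exact mul_zero _
  · exact fun h => absurd (Finset.mem_univ i) h

theorem sumIdem_smul (V : Set ι) (M : Mdl Λᵐᵒᵖ) (m : M) [DecidablePred (· ∈ V)] :
    op (sumIdem e V) • m = ∑ i : ι, if i ∈ V then op (e i) • m else 0 := by
  rw [sumIdem, Finset.op_sum, Finset.sum_smul]
  refine Finset.sum_congr rfl fun i _ => ?_
  split_ifs
  · rfl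
  · rw [op_zero, zero_smul]

theorem homZero_projMod_sumIdem_iff (he : CompletePrimIdems Λ e) (V : Set ι) (T : Mdl Λᵐᵒᵖ) :
    HomZero (projMod Λ (sumIdem e V)) T ↔ ∀ i ∈ V, i ∉ Supp Λ e T := by
  classical
  obtain ⟨u, hu⟩ := exists_represents (sumIdem e V)
  constructor
  · rintro h i hi ⟨m, hm⟩
    obtain ⟨φ, hφ⟩ := hu.exists_map T (op (e i) • m) (by
      rw [← mul_smul, ← op_mul, mul_sumIdem he hi])
    rw [h φ] at hφ
    exact hm hφ.symm
  · intro h φ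
    refine hu.hom_ext ?_
    rw [← hu.smul_eq, map_smul, sumIdem_smul, LinearMap.zero_apply]
    refine Finset.sum_eq_zero fun i _ => ?_
    split_ifs with hi
    · exact notMem_vsupp.1 (h i hi) _
    · rfl

theorem inAdd_projMod_sumIdem_iff (he : CompletePrimIdems Λ e) (hb : IsBasicAlg Λ e) (V : Set ι)
    (T : Mdl Λᵐᵒᵖ) :
    InAdd (projMod Λ (sumIdem e V)) T ↔ MemFac T ((projSystem he hb).projSum V) := by
  classical
  set S := projSystem he hb with hS
  obtain ⟨u, hu⟩ := exists_represents (sumIdem e V)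
  constructor
  · rintro ⟨n, f, g, hgf⟩
    have h1 : MemFac T (projMod Λ (sumIdem e V)) :=
      ⟨n, g, fun y => ⟨f y, LinearMap.congr_fun hgf y⟩⟩
    refine S.memFac_projSum_iff.2 fun i hi => ?_
    obtain ⟨φ, hφ⟩ := hu.exists_map (S.P i) (S.gen i) (by
      rw [← S.smul_gen, ← mul_smul, ← op_mul, mul_sumIdem he hi])
    exact h1.of_surjective φ (surjective_of_span (S.span_gen i) φ u hφ)
  · intro h
    have hfin : Module.Finite Λᵐᵒᵖ (projMod Λ (sumIdem e V)) :=
      ⟨⟨{u}, by simpa using hu.span⟩⟩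
    have h1 : MemFac (S.projSum V) (projMod Λ (sumIdem e V)) := by
      refine MemFac.of_span {y | ∃ i ∈ V, y = op (e i) • u} ?_ ?_
      · rw [eq_top_iff, ← hu.span, Submodule.span_le, Set.singleton_subset_iff]
        change u ∈ Submodule.span _ _
        nth_rw 2 [← hu.smul_eq]
        rw [sumIdem_smul]
        refine Submodule.sum_mem _ fun i _ => ?_
        split_ifs with hi
        · exact Submodule.subset_span ⟨i, hi, rfl⟩
        · exact Submodule.zero_mem _
      · rintro _ ⟨i, hi, rfl⟩
        obtain ⟨φ, hφ⟩ := S.exists_map i (projMod Λ (sumIdem e V)) (op (e i) • u)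
          (by rw [← mul_smul, S.idem])
        exact ⟨φ.comp (LinearMap.proj (φ := fun i : V => S.P i) ⟨i, hi⟩),
          Pi.single ⟨i, hi⟩ (S.gen i), by simp [hφ]⟩
    obtain ⟨n, g, hg⟩ := h.trans h1
    obtain ⟨y, hy⟩ := hg u
    have hidem : sumIdem e V * sumIdem e V = sumIdem e V := by
      conv_lhs => rw [sumIdem.eq_def e V, Finset.sum_mul]
      rw [sumIdem]
      refine Finset.sum_congr rfl fun i _ => ?_
      split_ifs with hi
      · exact mul_sumIdem he hi
      · exact zero_mul _
    obtain ⟨f, hf⟩ := hu.exists_map (ModuleCat.of Λᵐᵒᵖ (Fin n → T)) (op (sumIdem e V) • y) (by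
      rw [← mul_smul, ← op_mul, hidem])
    refine ⟨n, f, g, hu.hom_ext ?_⟩
    rw [LinearMap.comp_apply, hf]
    refine (map_smul g _ _).trans ?_
    rw [hy, hu.smul_eq, LinearMap.id_apply]

end RightModules

theorem isTauTiltingMod_iff {Λ : Type} [Ring Λ] [IsArtinianRing Λᵐᵒᵖ] {ι : Type} [Fintype ι]
    {e : ι → Λ} {T : Mdl Λᵐᵒᵖ} (hT : IsBSTT Λ e T) :
    IsTauTiltingMod Λ e T ↔ Supp Λ e T = Set.univ := by
  have hcard : (Set.univ : Set ι).ncard = Fintype.card ι := by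
    rw [Set.ncard_univ, Nat.card_eq_fintype_card]
  have hfin : Module.Finite Λᵐᵒᵖ T := hT.1.1
  constructor
  · rintro h
    refine Set.eq_of_subset_of_ncard_le (Set.subset_univ _) ?_ (Set.toFinite _)
    exact (hcard.trans (h.2.unique hT.1.2.2)).le
  · intro h
    have h1 := hT.1.2.2
    rw [h, hcard] at h1
    exact ⟨hT.1, h1⟩

end TauTilting

open TauTilting in
open scoped Classical in
/-- A poset isomorphism `ρ : sτtilt Λ → sτtilt Γ`, with induced
bijection `σ` on vertices (`ρ(X_i) = X_{σ(i)}`), restricts to the subposets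
`sτtilt_{(0,eΛ)}` and `sτtilt_{(eΛ,0)}`, preserves supports
(`supp(ρ(T)) = σ(supp(T))`), and in particular sends τ-tilting modules to
τ-tilting modules. -/
theorem statement3
    (K : Type) [Field K]
    (Λ : Type) [Ring Λ] [Algebra K Λ] [FiniteDimensional K Λ]
    (ι : Type) [Fintype ι] (e : ι → Λ)
    (he : CompletePrimIdems Λ e) (hbasic : IsBasicAlg Λ e)
    (Γ : Type) [Ring Γ] [Algebra K Γ] [FiniteDimensional K Γ]
    (ι' : Type) [Fintype ι'] (f : ι' → Γ)
    (hf : CompletePrimIdems Γ f) (hbasic' : IsBasicAlg Γ f)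
    (ρ : PosetIsoP (IsBSTT Λ e) (IsBSTT Γ f))
    (σ : ι → ι')
    (hσ : ∀ i, PE (ρ.toFun (cyclicQuot Λ (e i))) (cyclicQuot Γ (f (σ i)))) :
    -- (1)
    (∀ (V : Set ι) (eS : Λ) (eS' : Γ),
      eS = (∑ i : ι, if i ∈ V then e i else 0) →
      eS' = (∑ i : ι, if i ∈ V then f (σ i) else 0) →
      ∀ T, IsBSTT Λ e T →
        ((HomZero (projMod Λ eS) T ↔ HomZero (projMod Γ eS') (ρ.toFun T)) ∧
         (InAdd (projMod Λ eS) T ↔ InAdd (projMod Γ eS') (ρ.toFun T)))) ∧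
    -- (2)
    (∀ T, IsBSTT Λ e T →
      Supp Γ f (ρ.toFun T) = σ '' Supp Λ e T ∧
      (IsTauTiltingMod Λ e T ↔ IsTauTiltingMod Γ f (ρ.toFun T))) := by
  have := IsArtinianRing.of_finite K Λᵐᵒᵖ
  have := IsArtinianRing.of_finite K Γᵐᵒᵖ
  have hX := isLargestQuotient_cyclicQuot he hbasic
  have hX' := isLargestQuotient_cyclicQuot hf hbasic'
  have hbij := (projSystem he hbasic).bijective_of_posetIso (projSystem hf hbasic') ρ hX hX' hσ
  have hsupp : ∀ T, IsBSTT Λ e T → Supp Γ f (ρ.toFun T) = σ '' Supp Λ e T := fun T hT =>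
    (projSystem he hbasic).vsupp_eq_of_posetIso (projSystem hf hbasic') ρ hX hX' hσ hT
  refine ⟨?_, fun T hT => ⟨hsupp T hT, ?_⟩⟩
  · rintro V _ _ rfl rfl T hT
    have hsum : (∑ i : ι, if i ∈ V then f (σ i) else 0) = sumIdem f (σ '' V) := by
      rw [sumIdem, ← hbij.sum_comp]
      simp only [hbij.1.mem_set_image]
    rw [hsum]
    refine ⟨(homZero_projMod_sumIdem_iff he V T).trans
      (Iff.trans ?_ (homZero_projMod_sumIdem_iff hf (σ '' V) _).symm),
      (inAdd_projMod_sumIdem_iff he hbasic V T).trans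
      (Iff.trans ?_ (inAdd_projMod_sumIdem_iff hf hbasic' (σ '' V) _).symm)⟩
    · rw [hsupp T hT, Set.forall_mem_image]
      simp only [hbij.1.mem_set_image]
    · exact (projSystem he hbasic).memFac_projSum_iff_of_posetIso (projSystem hf hbasic')
        ρ hX hX' hσ K hT V
  · rw [isTauTiltingMod_iff hT, isTauTiltingMod_iff (ρ.maps T hT), hsupp T hT]
    constructor
    · intro h
      rw [h, Set.image_univ, hbij.2.range_eq]
    · intro h
      rwa [← hbij.1.image_injective.eq_iff, Set.image_univ, hbij.2.range_eq]
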